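/- arXiv:2011.11982 — 2 statements merged into one kernel-verified Lean document; each statement's English description precedes it below -/
import Mathlib

section
/- Let ω_{i,j}, σ_{i,j} (i ∈ {1,2}, j = 1,…,N) be weight functions and define on ℝ^{2N}: Ω(x,y) = Σ_j ω_{1,j}(x_j) + Σ_j ω_{2,j}(y_j), Σ(ξ,η) = Σ_j σ_{1,j}(ξ_j) + Σ_j σ_{2,j}(η_j), Ω₁(x,y) = Σ_j ω_{1,j}(x_j) + Σ_j σ_{2,j}(y_j), Σ₁(ξ,η) = Σ_j σ_{1,j}(ξ_j) + Σ_j ω_{2,j}(η_j). Then the partial Fourier transforms satisfy: (1) if F ∈ S_Ω^Σ(ℝ^{2N}) then F₂F ∈ S_{Ω₁}^{Σ₁}(ℝ^{2N}); (2) if F ∈ S_Ω^Σ(ℝ^{2N}) then F₁F ∈ S_{Σ₁}^{Ω₁}(ℝ^{2N}). -/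
open MeasureTheory Filter
open scoped ENNReal NNReal

noncomputable section

/-- Euclidean pairing `x·ξ = ∑ x_j ξ_j`. -/
def dotR {M : ℕ} (x ξ : Fin M → ℝ) : ℝ := ∑ j, x j * ξ j

/-- Fourier transform with kernel `e^{-i x·ξ}`. -/
def FT {M : ℕ} (f : (Fin M → ℝ) → ℂ) (ξ : Fin M → ℝ) : ℂ :=
  ∫ x, Complex.exp (-(Complex.I * (dotR x ξ : ℂ))) * f x

/-- sup-norm (in `ℝ≥0∞`) of a complex-valued function. -/
def supNorm {M : ℕ} (f : (Fin M → ℝ) → ℂ) : ℝ≥0∞ := ⨆ x, (‖f x‖₊ : ℝ≥0∞)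

/-- partial derivative `∂_j`. -/
def pD {M : ℕ} (j : Fin M) (f : (Fin M → ℝ) → ℂ) : (Fin M → ℝ) → ℂ :=
  fun x => fderiv ℝ f x (Pi.single j 1)

/-- iterated partial derivative `∂^α`. -/
def pDpow {M : ℕ} (α : Fin M → ℕ) (f : (Fin M → ℝ) → ℂ) : (Fin M → ℝ) → ℂ :=
  ((List.ofFn fun j : Fin M => (pD j)^[α j]).foldr (· ∘ ·) id) f

/-- `D^α = (-i)^{|α|} ∂^α`. -/
def Dpow {M : ℕ} (α : Fin M → ℕ) (f : (Fin M → ℝ) → ℂ) : (Fin M → ℝ) → ℂ :=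
  fun x => (-Complex.I) ^ (∑ j, α j) * pDpow α f x

/-- multiplication by the monomial `x^α`. -/
def monMul {M : ℕ} (α : Fin M → ℕ) (f : (Fin M → ℝ) → ℂ) : (Fin M → ℝ) → ℂ :=
  fun x => ((∏ j, (x j) ^ (α j) : ℝ) : ℂ) * f x

/-- Weight function in the sense of the paper (extended to `ℝ` by `ω x = ω |x|`):
continuous, increasing on `[0,∞)`, nonnegative, together with conditions
(α), (β), (γ), (δ). -/
structure IsWeightFun (ω : ℝ → ℝ) : Prop where
  nonneg : ∀ x, 0 ≤ ω x
  eq_abs : ∀ x, ω x = ω |x|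
  continuous : Continuous ω
  mono : MonotoneOn ω (Set.Ici 0)
  alphaCond : ∃ K, 1 ≤ K ∧ ∀ x, 0 ≤ x → ω (2 * x) ≤ K * (1 + ω x)
  betaCond : Filter.Tendsto (fun x => ω x / x) Filter.atTop (nhds 0)
  gammaCond : ∃ a b : ℝ, 0 < b ∧ ∀ x, 0 ≤ x → a + b * Real.log (1 + x) ≤ ω x
  deltaCond : ConvexOn ℝ (Set.Ici 0) fun t => ω (Real.exp t)

/-- non-isotropic weight `Ω(x) = ω_1(x_1) + ⋯ + ω_M(x_M)`. -/
def wSum {M : ℕ} (ω : Fin M → ℝ → ℝ) (x : Fin M → ℝ) : ℝ := ∑ j, ω j (x j)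

/-- Membership in the space `S_Ω^Σ(ℝ^M)`: `f ∈ L¹`, `f` and `f̂` smooth, and for
every `λ > 0` and every multi-index `α`, `‖e^{λΩ} D^α f‖_∞ < ∞` and
`‖e^{λΣ} D^α f̂‖_∞ < ∞`. -/
structure MemS {M : ℕ} (Om Sig : (Fin M → ℝ) → ℝ) (f : (Fin M → ℝ) → ℂ) : Prop where
  integrable : Integrable f
  smooth : ContDiff ℝ (⊤ : ℕ∞) f
  smooth_ft : ContDiff ℝ (⊤ : ℕ∞) (FT f)
  decay : ∀ lam : ℝ, 0 < lam → ∀ α : Fin M → ℕ,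
      supNorm (fun x => (Real.exp (lam * Om x) : ℂ) * Dpow α f x) < ⊤
  decay_ft : ∀ lam : ℝ, 0 < lam → ∀ α : Fin M → ℕ,
      supNorm (fun ξ => (Real.exp (lam * Sig ξ) : ℂ) * Dpow α (FT f) ξ) < ⊤

/-- first block of variables of `z ∈ ℝ^{2N}`. -/
def firstB {N : ℕ} (z : Fin (N + N) → ℝ) : Fin N → ℝ := fun j => z (Fin.castAdd N j)

/-- second block of variables of `z ∈ ℝ^{2N}`. -/
def secondB {N : ℕ} (z : Fin (N + N) → ℝ) : Fin N → ℝ := fun j => z (Fin.natAdd N j)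

/-- the weight `(z₁,z₂) ↦ ∑_j a_j((z₁)_j) + ∑_j b_j((z₂)_j)` on `ℝ^{2N}`. -/
def wOm {N : ℕ} (a b : Fin N → ℝ → ℝ) (z : Fin (N + N) → ℝ) : ℝ :=
  (∑ j, a j (firstB z j)) + ∑ j, b j (secondB z j)

/-- partial Fourier transform in the first block of `N` variables. -/
def FT1 {N : ℕ} (u : (Fin (N + N) → ℝ) → ℂ) (z : Fin (N + N) → ℝ) : ℂ :=
  ∫ x : Fin N → ℝ, Complex.exp (-(Complex.I * (dotR x (firstB z) : ℂ))) *
    u (Fin.append x (secondB z))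

/-- partial Fourier transform in the second block of `N` variables. -/
def FT2 {N : ℕ} (u : (Fin (N + N) → ℝ) → ℂ) (z : Fin (N + N) → ℝ) : ℂ :=
  ∫ ξ : Fin N → ℝ, Complex.exp (-(Complex.I * (dotR ξ (secondB z) : ℂ))) *
    u (Fin.append (firstB z) ξ)

/-- `f` and all its iterated partial derivatives are differentiable and, for every `λ > 0`,
bounded by a multiple of `e^{-λW}`; stated through a family closed under partial derivatives. -/
def Dec {M : ℕ} (W : (Fin M → ℝ) → ℝ) (f : (Fin M → ℝ) → ℂ) : Prop :=
  ∃ P : ((Fin M → ℝ) → ℂ) → Prop, P f ∧ ∀ g, P g → Differentiable ℝ g ∧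
    (∀ lam : ℝ, 0 < lam → ∃ C, ∀ z, Real.exp (lam * W z) * ‖g z‖ ≤ C) ∧ ∀ j, P (pD j g)

/-- `W` dominates the logarithm, up to affine changes. -/
def LogLow {M : ℕ} (W : (Fin M → ℝ) → ℝ) : Prop :=
  ∃ B A : ℝ, 0 ≤ B ∧ ∀ z, Real.log (1 + ‖z‖) ≤ B * W z + A

section Dec

variable {M : ℕ} {W : (Fin M → ℝ) → ℝ} {f g : (Fin M → ℝ) → ℂ}

lemma Dec.differentiable (h : Dec W f) : Differentiable ℝ f := by
  obtain ⟨P, hP, H⟩ := h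
  exact (H f hP).1

lemma Dec.bound (h : Dec W f) {lam : ℝ} (hl : 0 < lam) :
    ∃ C, ∀ z, Real.exp (lam * W z) * ‖f z‖ ≤ C := by
  obtain ⟨P, hP, H⟩ := h
  exact (H f hP).2.1 lam hl

lemma Dec.pD (h : Dec W f) (j : Fin M) : Dec W (pD j f) := by
  obtain ⟨P, hP, H⟩ := h
  exact ⟨P, (H f hP).2.2 j, H⟩

lemma Dec.lincomb (hf : Dec W f) (hg : Dec W g) (a b : ℂ) :
    Dec W (fun z => a * f z + b * g z) := by
  refine ⟨fun h => ∃ f g, Dec W f ∧ Dec W g ∧ h = fun z => a * f z + b * g z,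
    ⟨f, g, hf, hg, rfl⟩, ?_⟩
  rintro _ ⟨f, g, hf, hg, rfl⟩
  have df := hf.differentiable
  have dg := hg.differentiable
  refine ⟨by fun_prop, fun lam hl => ?_, fun j => ⟨_, _, hf.pD j, hg.pD j, ?_⟩⟩
  · obtain ⟨C, hC⟩ := hf.bound hl
    obtain ⟨D, hD⟩ := hg.bound hl
    refine ⟨‖a‖ * C + ‖b‖ * D, fun z => ?_⟩
    calc _ ≤ Real.exp (lam * W z) * (‖a * f z‖ + ‖b * g z‖) := by
          gcongr; exact norm_add_le _ _
      _ = ‖a‖ * (Real.exp (lam * W z) * ‖f z‖) + ‖b‖ * (Real.exp (lam * W z) * ‖g z‖) := by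
          rw [norm_mul, norm_mul]; ring
      _ ≤ _ := by gcongr; exacts [hC z, hD z]
  · ext z
    simp only [_root_.pD]
    rw [fderiv_fun_add (by fun_prop) (by fun_prop), fderiv_const_mul (by fun_prop),
      fderiv_const_mul (by fun_prop)]
    simp

lemma one_add_norm_rpow_le {B A w n r : ℝ} (hn : 0 ≤ n) (hr : 0 ≤ r)
    (h : Real.log (1 + n) ≤ B * w + A) :
    (1 + n) ^ r ≤ Real.exp (r * A) * Real.exp (r * B * w) := by
  rw [Real.rpow_def_of_pos (by linarith), ← Real.exp_add]
  gcongr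
  nlinarith

lemma pD_coord_mul {c : ℂ} {k j : Fin M} {G : (Fin M → ℝ) → ℂ} (hG : Differentiable ℝ G) :
    pD j (fun z => c * (z k : ℂ) * G z) =
      fun z => c * (z k : ℂ) * pD j G z + (if j = k then c else 0) * G z := by
  ext z
  have h1 : HasFDerivAt (fun z : Fin M → ℝ => c * (z k : ℂ))
      (c • (Complex.ofRealCLM ∘L ContinuousLinearMap.proj k)) z :=
    (Complex.ofRealCLM.hasFDerivAt.comp z
      (ContinuousLinearMap.proj (R := ℝ) (φ := fun _ : Fin M => ℝ) k).hasFDerivAt).const_mul c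
  have h2 : HasFDerivAt (fun z => c * (z k : ℂ) * G z) _ z := h1.mul (hG z).hasFDerivAt
  simp only [_root_.pD]
  rw [h2.fderiv]
  by_cases hjk : j = k
  · subst hjk; simp; ring
  · simp [hjk]

lemma Dec.coord_mul (hW : LogLow W) (hf : Dec W f) (c : ℂ) (k : Fin M) :
    Dec W (fun z => c * (z k : ℂ) * f z) := by
  refine ⟨fun h => ∃ f g, Dec W f ∧ Dec W g ∧ h = fun z => c * (z k : ℂ) * f z + g z,
    ⟨f, fun z => 0 * f z + 0 * f z, hf, hf.lincomb hf 0 0, by simp⟩, ?_⟩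
  rintro _ ⟨f, g, hf, hg, rfl⟩
  have df := hf.differentiable
  have dg := hg.differentiable
  have dk : Differentiable ℝ (fun z : Fin M → ℝ => (z k : ℂ)) :=
    Complex.ofRealCLM.differentiable.comp (differentiable_apply k)
  have d1 : Differentiable ℝ (fun z : Fin M → ℝ => c * (z k : ℂ) * f z) :=
    (dk.const_mul c).mul df
  refine ⟨d1.add dg, fun lam hl => ?_, fun j => ⟨_, _, hf.pD j,
    hf.lincomb (hg.pD j) (if j = k then c else 0) 1, ?_⟩⟩
  · obtain ⟨B, A, hB, hBA⟩ := hW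
    obtain ⟨C, hC⟩ := hf.bound (add_pos_of_pos_of_nonneg hl hB)
    obtain ⟨D, hD⟩ := hg.bound hl
    refine ⟨‖c‖ * (Real.exp A * C) + D, fun z => ?_⟩
    have hz : |z k| ≤ Real.exp A * Real.exp (B * W z) := by
      have := one_add_norm_rpow_le (norm_nonneg z) zero_le_one (hBA z)
      simp only [Real.rpow_one, one_mul] at this
      have h2 := norm_le_pi_norm z k
      rw [Real.norm_eq_abs] at h2
      linarith
    calc _ ≤ Real.exp (lam * W z) * (‖c * (z k : ℂ) * f z‖ + ‖g z‖) := by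
          gcongr; exact norm_add_le _ _
      _ = ‖c‖ * (Real.exp (lam * W z) * |z k| * ‖f z‖) + Real.exp (lam * W z) * ‖g z‖ := by
          rw [norm_mul, norm_mul, Complex.norm_real, Real.norm_eq_abs]; ring
      _ ≤ ‖c‖ * (Real.exp (lam * W z) * (Real.exp A * Real.exp (B * W z)) * ‖f z‖) + D := by
          gcongr; exact hD z
      _ = ‖c‖ * (Real.exp A * (Real.exp ((lam + B) * W z) * ‖f z‖)) + D := by
          rw [add_mul lam B, Real.exp_add]; ring
      _ ≤ _ := by gcongr; exact hC z
  · have : _root_.pD j (fun z => c * (z k : ℂ) * f z + g z) =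
        fun z => _root_.pD j (fun z => c * (z k : ℂ) * f z) z + _root_.pD j g z := by
      ext z
      simp only [_root_.pD]
      rw [fderiv_fun_add (d1 z) (dg z)]
      rfl
    rw [this, pD_coord_mul df]
    ext z
    ring

lemma fderiv_eq_sum_pD (z : Fin M → ℝ) :
    fderiv ℝ f z = ∑ j, (ContinuousLinearMap.proj (R := ℝ) (φ := fun _ : Fin M => ℝ) j).smulRight
      (pD j f z) := by
  ext v
  conv_lhs => rw [pi_eq_sum_univ' v, map_sum]
  simp only [sum_apply, ContinuousLinearMap.smulRight_apply, map_smul, pD,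
    ContinuousLinearMap.proj_apply]

lemma Dec.contDiff (h : Dec W f) : ContDiff ℝ (⊤ : ℕ∞) f := by
  have key : ∀ n : ℕ, ∀ f, Dec W f → ContDiff ℝ n f := by
    intro n
    induction n with
    | zero => exact fun f hf => contDiff_zero.2 hf.differentiable.continuous
    | succ n ih =>
      intro f hf
      push_cast
      refine contDiff_succ_iff_fderiv.2 ⟨hf.differentiable, by simp, ?_⟩
      rw [show fderiv ℝ f = _ from funext fderiv_eq_sum_pD]
      refine ContDiff.sum fun j _ => ?_
      exact contDiff_const.smulRight (ih _ (hf.pD j))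
  exact contDiff_infty.2 fun n => key n f h

lemma Dec.mono {W' : (Fin M → ℝ) → ℝ} (h : Dec W f) (hW : ∀ z, W' z ≤ W z) : Dec W' f := by
  refine ⟨Dec W, h, fun g hg => ⟨hg.differentiable, fun lam hl => ?_, hg.pD⟩⟩
  obtain ⟨C, hC⟩ := hg.bound hl
  exact ⟨C, fun z => le_trans (by gcongr; exact hW z) (hC z)⟩

/-- Decay with respect to two weights gives decay with respect to their sum. -/
lemma Dec.add_weight {W' : (Fin M → ℝ) → ℝ} (h : Dec W f) (h' : Dec W' f) :
    Dec (fun z => W z + W' z) f := by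
  refine ⟨fun g => Dec W g ∧ Dec W' g, ⟨h, h'⟩, fun g hg => ⟨hg.1.differentiable,
    fun lam hl => ?_, fun j => ⟨hg.1.pD j, hg.2.pD j⟩⟩⟩
  obtain ⟨C, hC⟩ := hg.1.bound (mul_pos two_pos hl)
  obtain ⟨D, hD⟩ := hg.2.bound (mul_pos two_pos hl)
  refine ⟨C + D, fun z => le_trans ?_ (add_le_add (hC z) (hD z))⟩
  rw [← add_mul]
  gcongr
  rw [mul_add, Real.exp_add, mul_assoc, mul_assoc, two_mul, two_mul, Real.exp_add, Real.exp_add]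
  nlinarith [sq_nonneg (Real.exp (lam * W z) - Real.exp (lam * W' z)),
    sq_nonneg (Real.exp (lam * W z)), sq_nonneg (Real.exp (lam * W' z))]

/-- A coordinate permutation followed by a rescaling of the coordinates. -/
def permScale (π : Equiv.Perm (Fin M)) (ε : Fin M → ℝ) (z : Fin M → ℝ) : Fin M → ℝ :=
  fun i => ε i * z (π i)

lemma Dec.comp_permScale (h : Dec W f) (π : Equiv.Perm (Fin M)) (ε : Fin M → ℝ) (c : ℂ) :
    Dec (fun z => W (permScale π ε z)) (fun z => c * f (permScale π ε z)) := by
  refine ⟨fun g => ∃ c f, Dec W f ∧ g = fun z => c * f (permScale π ε z), ⟨c, f, h, rfl⟩, ?_⟩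
  rintro _ ⟨c, f, hf, rfl⟩
  let T : (Fin M → ℝ) →L[ℝ] (Fin M → ℝ) :=
    ContinuousLinearMap.pi fun i => ε i • ContinuousLinearMap.proj (π i)
  have hT : ∀ z, T z = permScale π ε z := fun z => by ext i; simp [T, permScale]
  have hd : ∀ z, HasFDerivAt (fun z => c * f (permScale π ε z))
      (c • (fderiv ℝ f (permScale π ε z) ∘L T)) z := by
    intro z
    have h1 : HasFDerivAt f (fderiv ℝ f (permScale π ε z)) (T z) := by
      rw [hT]; exact (hf.differentiable _).hasFDerivAt
    have h2 := (h1.comp z T.hasFDerivAt).const_mul c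
    simpa [Function.comp_def, hT] using h2
  refine ⟨fun z => (hd z).differentiableAt, fun lam hl => ?_, fun j =>
    ⟨c * ε (π.symm j), _, hf.pD (π.symm j), ?_⟩⟩
  · obtain ⟨C, hC⟩ := hf.bound hl
    refine ⟨‖c‖ * C, fun z => ?_⟩
    rw [norm_mul, mul_left_comm]
    gcongr
    exact hC _
  · ext z
    simp only [_root_.pD]
    rw [(hd z).fderiv]
    have : T (Pi.single j 1) = ε (π.symm j) • Pi.single (π.symm j) 1 := by
      ext i
      by_cases hi : i = π.symm j
      · subst hi; simp [T]
      · have : π i ≠ j := fun h => hi (by rw [← h]; simp)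
        simp [T, hi, this]
    simp [this, mul_assoc]

end Dec
section MultiIndex

variable {M : ℕ} {f : (Fin M → ℝ) → ℂ}

lemma ContDiff.pD (hf : ContDiff ℝ (⊤ : ℕ∞) f) (j : Fin M) : ContDiff ℝ (⊤ : ℕ∞) (pD j f) :=
  (hf.fderiv_right (m := (⊤ : ℕ∞)) (by simp)).clm_apply contDiff_const

lemma pD_comm (hf : ContDiff ℝ (⊤ : ℕ∞) f) (j k : Fin M) :
    pD j (pD k f) = pD k (pD j f) := by
  have hs : ∀ z, IsSymmSndFDerivAt ℝ f z := fun z =>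
    hf.contDiffAt.isSymmSndFDerivAt (by simp; exact WithTop.coe_le_coe.2 le_top)
  have hd : Differentiable ℝ (fderiv ℝ f) :=
    (hf.fderiv_right (m := (⊤ : ℕ∞)) (by simp)).differentiable (by simp)
  have key : ∀ j k : Fin M, ∀ z, pD j (pD k f) z =
      fderiv ℝ (fderiv ℝ f) z (Pi.single j 1) (Pi.single k 1) := by
    intro j k z
    have h : HasFDerivAt (fun z => fderiv ℝ f z (Pi.single k 1)) _ z :=
      (hd z).hasFDerivAt.clm_apply (hasFDerivAt_const (Pi.single k 1) z)
    change fderiv ℝ (fun z => fderiv ℝ f z (Pi.single k 1)) z (Pi.single j 1) = _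
    rw [h.fderiv]
    simp
  ext z
  rw [key, key, (hs z).eq]

lemma ContDiff.iterate_pD (hf : ContDiff ℝ (⊤ : ℕ∞) f) (j : Fin M) (n : ℕ) :
    ContDiff ℝ (⊤ : ℕ∞) ((_root_.pD j)^[n] f) := by
  induction n with
  | zero => exact hf
  | succ n ih => rw [Function.iterate_succ_apply']; exact ih.pD j

lemma iterate_pD_comm (hf : ContDiff ℝ (⊤ : ℕ∞) f) (j k : Fin M) (n : ℕ) :
    (pD j)^[n] (pD k f) = pD k ((pD j)^[n] f) := by
  induction n with
  | zero => rfl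
  | succ n ih => rw [Function.iterate_succ_apply', Function.iterate_succ_apply', ih,
      pD_comm (hf.iterate_pD j n)]

/-- Iterated partial derivatives along the indices of a list. -/
def pDList (L : List (Fin M)) (α : Fin M → ℕ) (f : (Fin M → ℝ) → ℂ) : (Fin M → ℝ) → ℂ :=
  ((L.map fun j => (pD j)^[α j]).foldr (· ∘ ·) id) f

lemma pDList_cons (j : Fin M) (L : List (Fin M)) (α : Fin M → ℕ) :
    pDList (j :: L) α f = (pD j)^[α j] (pDList L α f) := rfl

lemma pDpow_eq_pDList (α : Fin M → ℕ) : pDpow α f = pDList (List.finRange M) α f := by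
  rw [pDpow, pDList, List.ofFn_eq_map]

lemma ContDiff.pDList (hf : ContDiff ℝ (⊤ : ℕ∞) f) (L : List (Fin M)) (α : Fin M → ℕ) :
    ContDiff ℝ (⊤ : ℕ∞) (pDList L α f) := by
  induction L with
  | nil => exact hf
  | cons j L ih => rw [pDList_cons]; exact ih.iterate_pD j _

lemma pD_pDList (hf : ContDiff ℝ (⊤ : ℕ∞) f) (k : Fin M) (L : List (Fin M)) (α : Fin M → ℕ)
    (hL : L.Nodup) (hk : k ∈ L) :
    pD k (pDList L α f) = pDList L (Function.update α k (α k + 1)) f := by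
  have not_mem : ∀ L : List (Fin M), k ∉ L →
      pDList L (Function.update α k (α k + 1)) f = pDList L α f := by
    intro L hk
    induction L with
    | nil => rfl
    | cons j L ih =>
      simp only [List.mem_cons, not_or] at hk
      rw [pDList_cons, pDList_cons, ih hk.2, Function.update_of_ne (Ne.symm hk.1)]
  induction L with
  | nil => simp at hk
  | cons j L ih =>
    rw [List.nodup_cons] at hL
    rw [pDList_cons, pDList_cons]
    by_cases hjk : k = j
    · subst hjk
      rw [not_mem L hL.1, Function.update_self, Function.iterate_succ_apply']
    · have hkL : k ∈ L := by simpa [hjk] using hk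
      rw [← iterate_pD_comm (hf.pDList L α), ih hL.2 hkL, Function.update_of_ne (Ne.symm hjk)]

lemma norm_Dpow (α : Fin M → ℕ) (z : Fin M → ℝ) : ‖Dpow α f z‖ = ‖pDpow α f z‖ := by
  simp [Dpow]

lemma supNorm_lt_top_iff {g : (Fin M → ℝ) → ℂ} : supNorm g < ⊤ ↔ ∃ C, ∀ z, ‖g z‖ ≤ C := by
  rw [supNorm, ENNReal.iSup_coe_lt_top, bddAbove_def]
  constructor
  · rintro ⟨C, hC⟩
    exact ⟨C, fun z => by exact_mod_cast hC _ ⟨z, rfl⟩⟩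
  · rintro ⟨C, hC⟩
    refine ⟨C.toNNReal, ?_⟩
    rintro _ ⟨z, rfl⟩
    exact NNReal.coe_le_coe.1 ((hC z).trans (Real.le_coe_toNNReal C))

lemma dec_iff {W : (Fin M → ℝ) → ℝ} : Dec W f ↔ ContDiff ℝ (⊤ : ℕ∞) f ∧
    ∀ lam : ℝ, 0 < lam → ∀ α : Fin M → ℕ,
      supNorm (fun x => (Real.exp (lam * W x) : ℂ) * Dpow α f x) < ⊤ := by
  have hn : ∀ lam α z, ‖(Real.exp (lam * W z) : ℂ) * Dpow α f z‖ =
      Real.exp (lam * W z) * ‖pDpow α f z‖ := fun lam α z => by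
    rw [norm_mul, norm_Dpow, Complex.norm_real, Real.norm_of_nonneg (Real.exp_pos _).le]
  simp only [supNorm_lt_top_iff, hn]
  constructor
  · refine fun h => ⟨h.contDiff, fun lam hl α => Dec.bound (?_ : Dec W _) hl⟩
    rw [pDpow_eq_pDList]
    induction List.finRange M with
    | nil => exact h
    | cons j L ih =>
      rw [pDList_cons]
      induction α j with
      | zero => exact ih
      | succ n ihn => rw [Function.iterate_succ_apply']; exact ihn.pD j
  · rintro ⟨hf, hb⟩
    refine ⟨fun g => ∃ α, g = pDpow α f, ⟨0, ?_⟩, ?_⟩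
    · rw [pDpow_eq_pDList]
      induction List.finRange M with
      | nil => rfl
      | cons j L ih => rw [pDList_cons, ← ih]; rfl
    · rintro _ ⟨α, rfl⟩
      refine ⟨?_, fun lam hl => hb lam hl α, fun j =>
        ⟨Function.update α j (α j + 1), ?_⟩⟩
      · rw [pDpow_eq_pDList]
        exact (hf.pDList _ _).differentiable (by simp)
      · rw [pDpow_eq_pDList, pDpow_eq_pDList,
          pD_pDList hf j _ α (List.nodup_finRange M) (List.mem_finRange j)]

lemma memS_iff {Om Sig : (Fin M → ℝ) → ℝ} :
    MemS Om Sig f ↔ Integrable f ∧ Dec Om f ∧ Dec Sig (FT f) := by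
  rw [dec_iff, dec_iff]
  exact ⟨fun h => ⟨h.integrable, ⟨h.smooth, h.decay⟩, h.smooth_ft, h.decay_ft⟩,
    fun h => ⟨h.1, h.2.1.1, h.2.2.1, h.2.1.2, h.2.2.2⟩⟩

end MultiIndex

section Inversion

variable {N : ℕ}

lemma FT_comp_equiv (g : (Fin N → ℝ) → ℂ) (w : EuclideanSpace ℝ (Fin N)) :
    FourierTransform.fourier (fun v : EuclideanSpace ℝ (Fin N) => g (WithLp.ofLp v)) w =
      FT g ((2 * Real.pi) • WithLp.ofLp w) := by
  rw [Real.fourier_eq', FT, ← (PiLp.volume_preserving_ofLp (Fin N)).integral_comp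
    (MeasurableEquiv.toLp 2 (Fin N → ℝ)).symm.measurableEmbedding]
  refine integral_congr_ae (Eventually.of_forall fun v => ?_)
  simp only [smul_eq_mul]
  congr 2
  have : inner ℝ v w = ∑ j, v j * w j := by
    simp [PiLp.inner_apply, mul_comm]
  rw [this, dotR]
  push_cast
  simp only [Pi.smul_apply, smul_eq_mul, Finset.mul_sum, Finset.sum_mul, ← Finset.sum_neg_distrib]
  refine Finset.sum_congr rfl fun j _ => ?_
  push_cast
  ring

/-- Fourier inversion for the kernel `e^{-i x·ξ}`. -/
lemma FT_FT {g : (Fin N → ℝ) → ℂ} (hc : Continuous g) (hg : Integrable g)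
    (hFg : Integrable (FT g)) (x : Fin N → ℝ) :
    FT (FT g) x = (2 * Real.pi) ^ N * g (-x) := by
  let g' : EuclideanSpace ℝ (Fin N) → ℂ := fun v => g (WithLp.ofLp v)
  have hmp := PiLp.volume_preserving_ofLp (Fin N)
  have hme := (MeasurableEquiv.toLp 2 (Fin N → ℝ)).symm.measurableEmbedding
  have hπ : (2 * Real.pi) ≠ 0 := by positivity
  have hc' : Continuous g' := hc.comp (PiLp.continuous_ofLp 2 _)
  have hg' : Integrable g' := (hmp.integrable_comp_emb hme).2 hg
  have hF : FourierTransform.fourier g' = fun w => FT g ((2 * Real.pi) • WithLp.ofLp w) :=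
    funext (FT_comp_equiv g)
  have hFg' : Integrable (FourierTransform.fourier g') := by
    rw [hF]
    exact (hmp.integrable_comp_emb hme (g := fun v => FT g ((2 * Real.pi) • v))).2
      (hFg.comp_smul hπ)
  have h1 := hc'.fourierInv_fourier_eq hg' hFg'
  have h2 := congrFun h1 (WithLp.toLp 2 (-x))
  rw [Real.fourierInv_eq_fourier_neg, hF, FT_comp_equiv (fun v => FT g ((2 * Real.pi) • v))] at h2
  have h3 : g' (WithLp.toLp 2 (-x)) = g (-x) := rfl
  rw [h3] at h2
  rw [← h2, FT, FT]
  have h4 := Measure.integral_comp_smul (volume : Measure (Fin N → ℝ))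
    (fun v => Complex.exp (-(Complex.I * (dotR v x : ℂ))) * FT g v) (2 * Real.pi)
  have h5 : ∀ v : Fin N → ℝ, dotR v ((2 * Real.pi) • WithLp.ofLp (-WithLp.toLp 2 (-x))) =
      dotR ((2 * Real.pi) • v) x := by
    intro v
    simp only [dotR, Pi.smul_apply, smul_eq_mul]
    refine Finset.sum_congr rfl fun j _ => ?_
    simp
    ring
  simp only [h5]
  rw [h4, abs_of_pos (by positivity), Module.finrank_fin_fun, Complex.real_smul]
  push_cast
  rw [mul_inv_cancel_left₀]
  exact pow_ne_zero _ (by exact_mod_cast hπ)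

end Inversion
section Blocks

variable {N : ℕ}

@[simp] lemma firstB_append (x y : Fin N → ℝ) : firstB (Fin.append x y) = x := by
  ext j; simp [firstB]

@[simp] lemma secondB_append (x y : Fin N → ℝ) : secondB (Fin.append x y) = y := by
  ext j; simp [secondB, -Fin.natAdd_eq_addNat]

lemma append_firstB_secondB (z : Fin (N + N) → ℝ) : Fin.append (firstB z) (secondB z) = z :=
  Fin.append_castAdd_natAdd

lemma wOm_append (a b : Fin N → ℝ → ℝ) (x y : Fin N → ℝ) :
    wOm a b (Fin.append x y) = wSum a x + wSum b y := by
  simp [wOm, wSum]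

lemma wOm_eq_wSum_append (a b : Fin N → ℝ → ℝ) : wOm a b = wSum (Fin.append a b) := by
  ext z
  simp [wOm, wSum, Fin.sum_univ_add, firstB, secondB, -Fin.natAdd_eq_addNat]

lemma continuous_append :
    Continuous fun p : (Fin N → ℝ) × (Fin N → ℝ) => Fin.append p.1 p.2 := by
  refine continuous_pi fun i => ?_
  refine Fin.addCases (fun k => ?_) (fun k => ?_) i
  · simp only [Fin.append_left]; fun_prop
  · simp only [Fin.append_right]; fun_prop

lemma continuous_append_left (y : Fin N → ℝ) : Continuous fun x : Fin N → ℝ => Fin.append x y :=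
  continuous_append.comp (continuous_id.prodMk continuous_const)

lemma continuous_append_right (x : Fin N → ℝ) : Continuous fun y : Fin N → ℝ => Fin.append x y :=
  continuous_append.comp (continuous_const.prodMk continuous_id)

/-- Concatenation of the two blocks as a measurable equivalence. -/
def appendEquiv (N : ℕ) : ((Fin N → ℝ) × (Fin N → ℝ)) ≃ᵐ (Fin (N + N) → ℝ) :=
  (MeasurableEquiv.sumPiEquivProdPi fun _ : Fin N ⊕ Fin N => ℝ).symm.trans
    (MeasurableEquiv.piCongrLeft (fun _ => ℝ) finSumFinEquiv)

lemma appendEquiv_apply (p : (Fin N → ℝ) × (Fin N → ℝ)) :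
    appendEquiv N p = Fin.append p.1 p.2 := by
  ext i
  obtain ⟨s, rfl⟩ := finSumFinEquiv.surjective i
  simp only [appendEquiv, MeasurableEquiv.trans_apply, MeasurableEquiv.coe_piCongrLeft]
  rw [Equiv.piCongrLeft_apply_apply]
  rcases s with k | k <;> simp [MeasurableEquiv.sumPiEquivProdPi, -Fin.natAdd_eq_addNat]

lemma measurePreserving_appendEquiv : MeasurePreserving (appendEquiv N) volume volume :=
  (volume_measurePreserving_sumPiEquivProdPi_symm fun _ : Fin N ⊕ Fin N => ℝ).trans
    (volume_measurePreserving_piCongrLeft (fun _ => ℝ) finSumFinEquiv)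

lemma continuous_dotR {M : ℕ} (ξ : Fin M → ℝ) : Continuous fun x => dotR x ξ := by
  unfold dotR; fun_prop

lemma norm_kernel {M : ℕ} (x ξ : Fin M → ℝ) :
    ‖Complex.exp (-(Complex.I * (dotR x ξ : ℂ)))‖ = 1 := by
  rw [← mul_neg, ← Complex.ofReal_neg, Complex.norm_exp_I_mul_ofReal]

lemma integrable_kernel_mul {M : ℕ} {f : (Fin M → ℝ) → ℂ} (hf : Integrable f) (ξ : Fin M → ℝ) :
    Integrable fun x => Complex.exp (-(Complex.I * (dotR x ξ : ℂ))) * f x := by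
  refine hf.bdd_mul (c := 1) ?_ (Eventually.of_forall fun x => (norm_kernel x ξ).le)
  have := continuous_dotR ξ
  exact Continuous.aestronglyMeasurable (by fun_prop)

/-- The full Fourier transform is the composition of the partial ones. -/
lemma FT_eq_FT1_FT2 {u : (Fin (N + N) → ℝ) → ℂ} (hu : Integrable u) : FT u = FT1 (FT2 u) := by
  ext z
  have he := (appendEquiv N).measurableEmbedding
  have hmp := measurePreserving_appendEquiv (N := N)
  have hi := (hmp.integrable_comp_emb he).2 (integrable_kernel_mul hu z)
  rw [FT, ← hmp.integral_comp he, Measure.volume_eq_prod, integral_prod]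
  · refine integral_congr_ae (Eventually.of_forall fun x => ?_)
    simp only [FT2, appendEquiv_apply, firstB_append, secondB_append]
    rw [← integral_const_mul]
    refine integral_congr_ae (Eventually.of_forall fun y => ?_)
    simp only [← mul_assoc, ← Complex.exp_add]
    congr 2
    simp only [dotR, Fin.sum_univ_add, Fin.append_left, Fin.append_right, firstB, secondB]
    push_cast
    ring
  · exact hi

/-- Exchange of the two blocks. -/
def swapB (z : Fin (N + N) → ℝ) : Fin (N + N) → ℝ := Fin.append (secondB z) (firstB z)

@[simp] lemma swapB_swapB (z : Fin (N + N) → ℝ) : swapB (swapB z) = z := by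
  simp [swapB, append_firstB_secondB]

@[simp] lemma firstB_swapB (z : Fin (N + N) → ℝ) : firstB (swapB z) = secondB z := by
  simp [swapB]

@[simp] lemma secondB_swapB (z : Fin (N + N) → ℝ) : secondB (swapB z) = firstB z := by
  simp [swapB]

@[simp] lemma swapB_append (x y : Fin N → ℝ) : swapB (Fin.append x y) = Fin.append y x := by
  simp [swapB]

lemma wOm_swapB (a b : Fin N → ℝ → ℝ) (z : Fin (N + N) → ℝ) :
    wOm a b (swapB z) = wOm b a z := by
  simp [wOm, add_comm]

lemma permScale_finAddFlip (s t : ℝ) (z : Fin (N + N) → ℝ) :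
    permScale finAddFlip (Fin.append (fun _ => s) fun _ => t) z =
      Fin.append (s • secondB z) (t • firstB z) := by
  ext i
  refine Fin.addCases (fun k => ?_) (fun k => ?_) i <;>
    simp [permScale, firstB, secondB, -Fin.natAdd_eq_addNat]

lemma permScale_refl (s t : ℝ) (z : Fin (N + N) → ℝ) :
    permScale (Equiv.refl _) (Fin.append (fun _ => s) fun _ => t) z =
      Fin.append (s • firstB z) (t • secondB z) := by
  ext i
  refine Fin.addCases (fun k => ?_) (fun k => ?_) i <;>
    simp [permScale, firstB, secondB, -Fin.natAdd_eq_addNat]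

lemma Dec.comp_swapB {a b : Fin N → ℝ → ℝ} {f : (Fin (N + N) → ℝ) → ℂ} (h : Dec (wOm a b) f) :
    Dec (wOm b a) (fun z => f (swapB z)) := by
  have := h.comp_permScale finAddFlip (Fin.append (fun _ => 1) fun _ => 1) 1
  simp only [permScale_finAddFlip, one_smul, one_mul] at this
  exact this.mono fun z => (wOm_swapB a b z).ge

lemma FT1_eq_FT2_swapB (u : (Fin (N + N) → ℝ) → ℂ) :
    FT1 u = fun z => FT2 (fun w => u (swapB w)) (swapB z) := by
  ext z
  simp [FT1, FT2]

lemma FT_comp_swapB (u : (Fin (N + N) → ℝ) → ℂ) :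
    FT (fun w => u (swapB w)) = fun z => FT u (swapB z) := by
  have h : ∀ z : Fin (N + N) → ℝ, swapB z =
      MeasurableEquiv.piCongrLeft (fun _ => ℝ) finAddFlip z := by
    intro z
    ext i
    obtain ⟨j, rfl⟩ := finAddFlip.surjective i
    rw [MeasurableEquiv.coe_piCongrLeft, Equiv.piCongrLeft_apply_apply]
    refine Fin.addCases (fun k => ?_) (fun k => ?_) j <;>
      simp [swapB, firstB, secondB, -Fin.natAdd_eq_addNat]
  have hmp := volume_measurePreserving_piCongrLeft (fun _ : Fin (N + N) => ℝ)
    (finAddFlip : Fin (N + N) ≃ Fin (N + N))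
  ext z
  rw [FT, FT, ← hmp.integral_comp
    (MeasurableEquiv.piCongrLeft (fun _ => ℝ) finAddFlip).measurableEmbedding]
  refine integral_congr_ae (Eventually.of_forall fun w => ?_)
  simp only [← h, swapB_swapB]
  congr 4
  simp only [dotR, Fin.sum_univ_add, swapB, Fin.append_left, Fin.append_right, firstB, secondB]
  ring_nf

end Blocks

section Weights

lemma wSum_nonneg {M : ℕ} {ω : Fin M → ℝ → ℝ} (h : ∀ j, IsWeightFun (ω j)) (x : Fin M → ℝ) :
    0 ≤ wSum ω x := Finset.sum_nonneg fun j _ => (h j).nonneg _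

lemma logLow_wSum {M : ℕ} {ω : Fin M → ℝ → ℝ} (h : ∀ j, IsWeightFun (ω j)) :
    LogLow (wSum ω) := by
  choose a b hb hab using fun j => (h j).gammaCond
  have key : ∀ j, ∀ t, Real.log (1 + |t|) ≤ (b j)⁻¹ * (ω j t + |a j|) := by
    intro j t
    rw [← div_eq_inv_mul, le_div_iff₀ (hb j), (h j).eq_abs]
    have h1 := hab j |t| (abs_nonneg t)
    have h2 := neg_abs_le (a j)
    linarith
  have hB : ∀ j, (b j)⁻¹ ≤ ∑ i, (b i)⁻¹ := fun j =>
    Finset.single_le_sum (f := fun i => (b i)⁻¹) (fun i _ => (inv_pos.2 (hb i)).le)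
      (Finset.mem_univ j)
  have hB0 : 0 ≤ ∑ i, (b i)⁻¹ := Finset.sum_nonneg fun i _ => (inv_pos.2 (hb i)).le
  refine ⟨∑ i, (b i)⁻¹, (∑ i, (b i)⁻¹) * ∑ i, |a i|, hB0, fun z => ?_⟩
  rw [← mul_add, wSum, ← Finset.sum_add_distrib]
  have hs0 : ∀ i, 0 ≤ ω i (z i) + |a i| := fun i => add_nonneg ((h i).nonneg _) (abs_nonneg _)
  set c := (∑ i, (b i)⁻¹) * ∑ i, (ω i (z i) + |a i|) with hc
  have hc0 : 0 ≤ c := mul_nonneg hB0 (Finset.sum_nonneg fun i _ => hs0 i)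
  rw [Real.log_le_iff_le_exp (by positivity)]
  suffices ‖z‖ ≤ Real.exp c - 1 by linarith
  rw [pi_norm_le_iff_of_nonneg (by linarith [Real.one_le_exp hc0])]
  intro j
  have h1 : Real.log (1 + |z j|) ≤ c := (key j (z j)).trans <| by
    refine mul_le_mul (hB j) ?_ (hs0 j) hB0
    exact Finset.single_le_sum (f := fun i => ω i (z i) + |a i|) (fun i _ => hs0 i)
      (Finset.mem_univ j)
  rw [Real.log_le_iff_le_exp (by positivity)] at h1
  rw [Real.norm_eq_abs]
  linarith

lemma isWeightFun_append {N : ℕ} {a b : Fin N → ℝ → ℝ} (ha : ∀ j, IsWeightFun (a j))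
    (hb : ∀ j, IsWeightFun (b j)) (j : Fin (N + N)) : IsWeightFun (Fin.append a b j) := by
  refine Fin.addCases (fun k => ?_) (fun k => ?_) j
  · simpa using ha k
  · simpa [-Fin.natAdd_eq_addNat] using hb k

lemma logLow_wOm {N : ℕ} {a b : Fin N → ℝ → ℝ} (ha : ∀ j, IsWeightFun (a j))
    (hb : ∀ j, IsWeightFun (b j)) : LogLow (wOm a b) := by
  rw [wOm_eq_wSum_append]
  exact logLow_wSum (isWeightFun_append ha hb)

lemma exists_exp_neg_le {M : ℕ} {S : (Fin M → ℝ) → ℝ} (hS : LogLow S) :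
    ∃ mu K : ℝ, 0 < mu ∧ 0 < K ∧ ∀ lam, mu ≤ lam → ∀ x, 0 ≤ S x →
      Real.exp (-(lam * S x)) ≤ K * (1 + ‖x‖) ^ (-((M : ℝ) + 1)) := by
  obtain ⟨B, A, hB, h⟩ := hS
  refine ⟨(M + 1) * B + 1, Real.exp ((M + 1) * A), by positivity, Real.exp_pos _,
    fun lam hl x hx => ?_⟩
  have h1 := one_add_norm_rpow_le (norm_nonneg x) (r := (M : ℝ) + 1) (by positivity) (h x)
  rw [Real.rpow_neg (by positivity), ← div_eq_mul_inv, le_div_iff₀ (by positivity)]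
  calc _ ≤ Real.exp (-(lam * S x)) *
        (Real.exp ((M + 1) * A) * Real.exp ((M + 1) * B * S x)) := by gcongr
    _ = Real.exp ((M + 1) * A) * Real.exp ((M + 1) * B * S x - lam * S x) := by
        rw [sub_eq_add_neg, Real.exp_add]; ring
    _ ≤ Real.exp ((M + 1) * A) * 1 := by
        gcongr
        rw [Real.exp_le_one_iff]
        nlinarith
    _ = _ := mul_one _

lemma integrable_rpow_neg (M : ℕ) :
    Integrable fun x : Fin M → ℝ => (1 + ‖x‖) ^ (-((M : ℝ) + 1)) :=
  integrable_one_add_norm (by simp)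

lemma integrable_of_decay {M : ℕ} {S : (Fin M → ℝ) → ℝ} (hS : LogLow S) (hS0 : ∀ x, 0 ≤ S x)
    {g : (Fin M → ℝ) → ℂ} (hg : Continuous g)
    (hb : ∀ lam : ℝ, 0 < lam → ∃ C, ∀ x, Real.exp (lam * S x) * ‖g x‖ ≤ C) : Integrable g := by
  obtain ⟨mu, K, hmu, hK, h⟩ := exists_exp_neg_le hS
  obtain ⟨C, hC⟩ := hb mu hmu
  refine ((integrable_rpow_neg M).const_mul (C * K)).mono' hg.aestronglyMeasurable
    (Eventually.of_forall fun x => ?_)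
  have hC0 : 0 ≤ C := le_trans (by positivity) (hC x)
  calc ‖g x‖ = Real.exp (mu * S x) * ‖g x‖ * Real.exp (-(mu * S x)) := by
        rw [Real.exp_neg]; field_simp
    _ ≤ C * (K * (1 + ‖x‖) ^ (-((M : ℝ) + 1))) := by
        gcongr
        exacts [hC x, h mu le_rfl x (hS0 x)]
    _ = _ := by ring

end Weights
section PartialFourier

variable {N : ℕ} {a b : Fin N → ℝ → ℝ} {G : (Fin (N + N) → ℝ) → ℂ}

lemma Dec.slice_bound (hG : Dec (wOm a b) G) (ha : ∀ x, 0 ≤ wSum a x)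
    (hb : ∀ y, 0 ≤ wSum b y) (hbl : LogLow (wSum b)) {lam : ℝ} (hl : 0 < lam) :
    ∃ C, ∀ x y, Real.exp (lam * wSum a x) * ‖G (Fin.append x y)‖ ≤
      C * (1 + ‖y‖) ^ (-((N : ℝ) + 1)) := by
  obtain ⟨mu, K, hmu, hK, h⟩ := exists_exp_neg_le hbl
  obtain ⟨C, hC⟩ := hG.bound (add_pos hl hmu)
  refine ⟨C * K, fun x y => ?_⟩
  have h1 := hC (Fin.append x y)
  have hC0 : 0 ≤ C := le_trans (by positivity) h1
  rw [wOm_append] at h1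
  calc _ ≤ Real.exp (lam * wSum a x) * ‖G (Fin.append x y)‖ * Real.exp (mu * wSum a x) :=
        le_mul_of_one_le_right (by positivity) (Real.one_le_exp (mul_nonneg hmu.le (ha x)))
    _ = Real.exp ((lam + mu) * (wSum a x + wSum b y)) * ‖G (Fin.append x y)‖ *
        Real.exp (-((lam + mu) * wSum b y)) := by
        rw [mul_add, Real.exp_add, Real.exp_neg, add_mul lam mu (wSum a x), Real.exp_add]
        field_simp
    _ ≤ C * (K * (1 + ‖y‖) ^ (-((N : ℝ) + 1))) := by
        gcongr
        exact h _ (by linarith) y (hb y)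
    _ = _ := by ring

lemma Dec.slice_bound_zero (hG : Dec (wOm a b) G) (ha : ∀ x, 0 ≤ wSum a x)
    (hb : ∀ y, 0 ≤ wSum b y) (hbl : LogLow (wSum b)) :
    ∃ C, ∀ x y, ‖G (Fin.append x y)‖ ≤ C * (1 + ‖y‖) ^ (-((N : ℝ) + 1)) := by
  obtain ⟨C, hC⟩ := hG.slice_bound ha hb hbl one_pos
  refine ⟨C, fun x y => le_trans ?_ (hC x y)⟩
  exact le_mul_of_one_le_left (norm_nonneg _) (Real.one_le_exp (by simpa using ha x))

lemma Dec.continuous_slice (hG : Dec (wOm a b) G) (x : Fin N → ℝ) :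
    Continuous fun y => G (Fin.append x y) :=
  hG.differentiable.continuous.comp (continuous_append_right x)

lemma Dec.integrable_slice (hG : Dec (wOm a b) G) (ha : ∀ x, 0 ≤ wSum a x)
    (hb : ∀ y, 0 ≤ wSum b y) (hbl : LogLow (wSum b)) (x : Fin N → ℝ) :
    Integrable fun y => G (Fin.append x y) := by
  obtain ⟨C, hC⟩ := hG.slice_bound_zero ha hb hbl
  exact ((integrable_rpow_neg N).const_mul C).mono' (hG.continuous_slice x).aestronglyMeasurable
    (Eventually.of_forall (hC x))

/-- The function whose partial Fourier transform is the `j`-th derivative of that of `G`. -/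
def dualDeriv (G : (Fin (N + N) → ℝ) → ℂ) (j : Fin (N + N)) : (Fin (N + N) → ℝ) → ℂ :=
  Fin.addCases (fun k => pD (Fin.castAdd N k) G)
    (fun k z => -Complex.I * (z (Fin.natAdd N k) : ℂ) * G z) j

lemma Dec.dualDeriv (hG : Dec (wOm a b) G) (hW : LogLow (wOm a b)) (j : Fin (N + N)) :
    Dec (wOm a b) (dualDeriv G j) := by
  refine Fin.addCases (fun k => ?_) (fun k => ?_) j
  · simpa only [_root_.dualDeriv, Fin.addCases_left] using hG.pD _
  · simpa only [_root_.dualDeriv, Fin.addCases_right] using hG.coord_mul hW _ _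

lemma hasFDerivAt_integral_sum_smulRight {E α ι : Type*} [NormedAddCommGroup E]
    [NormedSpace ℝ E] [MeasurableSpace α] {μ : Measure α} [Fintype ι] (p : ι → E →L[ℝ] ℝ)
    {F : E → α → ℂ} {F' : ι → E → α → ℂ} {bound : ι → α → ℝ}
    (hF : ∀ z, Integrable (F z) μ) (hF' : ∀ j z, Integrable (F' j z) μ)
    (hb : ∀ j z x, ‖F' j z x‖ ≤ bound j x) (hbi : ∀ j, Integrable (bound j) μ)
    (hd : ∀ z x, HasFDerivAt (fun z => F z x) (∑ j, (p j).smulRight (F' j z x)) z) (z : E) :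
    HasFDerivAt (fun z => ∫ x, F z x ∂μ) (∑ j, (p j).smulRight (∫ x, F' j z x ∂μ)) z := by
  have hint : ∀ j, Integrable (fun x => (p j).smulRight (F' j z x)) μ := fun j =>
    (ContinuousLinearMap.smulRightL ℝ E ℂ (p j)).integrable_comp (hF' j z)
  have hmeas : AEStronglyMeasurable (fun x => ∑ j, (p j).smulRight (F' j z x)) μ :=
    Finset.aestronglyMeasurable_fun_sum Finset.univ
      fun j _ => (hint j).aestronglyMeasurable
  have hle : ∀ x w, ‖∑ j, (p j).smulRight (F' j w x)‖ ≤ ∑ j, ‖p j‖ * bound j x := fun x w =>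
    (norm_sum_le _ _).trans (Finset.sum_le_sum fun j _ => by
      rw [ContinuousLinearMap.norm_smulRight_apply]
      exact mul_le_mul_of_nonneg_left (hb j w x) (norm_nonneg _))
  have hsum : Integrable (fun x => ∑ j, ‖p j‖ * bound j x) μ :=
    integrable_finsetSum _ fun j _ => (hbi j).const_mul _
  have key : HasFDerivAt (fun z => ∫ x, F z x ∂μ) (∫ x, ∑ j, (p j).smulRight (F' j z x) ∂μ) z :=
    hasFDerivAt_integral_of_dominated_of_fderiv_le (𝕜 := ℝ) (s := Set.univ)
      (F' := fun z x => ∑ j, (p j).smulRight (F' j z x)) Filter.univ_mem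
      (Eventually.of_forall fun z => (hF z).aestronglyMeasurable) (hF z) hmeas
      (Eventually.of_forall fun x w _ => hle x w) hsum
      (Eventually.of_forall fun x w _ => hd w x)
  rw [integral_finsetSum _ fun j _ => hint j] at key
  refine key.congr_fderiv (Finset.sum_congr rfl fun j _ => ?_)
  exact (ContinuousLinearMap.smulRightL ℝ E ℂ (p j)).integral_comp_comm (hF' j z)

lemma hasFDerivAt_FT2_integrand (hG : Differentiable ℝ G) (y : Fin N → ℝ)
    (z : Fin (N + N) → ℝ) :
    HasFDerivAt (fun z => Complex.exp (-(Complex.I * (dotR y (secondB z) : ℂ))) *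
        G (Fin.append (firstB z) y))
      (∑ j, (ContinuousLinearMap.proj (R := ℝ) (φ := fun _ : Fin (N + N) => ℝ) j).smulRight
        (Complex.exp (-(Complex.I * (dotR y (secondB z) : ℂ))) *
          dualDeriv G j (Fin.append (firstB z) y))) z := by
  have hd : Differentiable ℝ fun z => Complex.exp (-(Complex.I * (dotR y (secondB z) : ℂ))) *
      G (Fin.append (firstB z) y) := by
    have h1 : Differentiable ℝ fun z : Fin (N + N) → ℝ => Fin.append (firstB z) y := by
      refine differentiable_pi.2 fun i => ?_
      refine Fin.addCases (fun k => ?_) (fun k => ?_) i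
      · simp only [Fin.append_left, firstB]; fun_prop
      · simp only [Fin.append_right]; fun_prop
    have h2 : Differentiable ℝ fun z : Fin (N + N) → ℝ => (dotR y (secondB z) : ℂ) := by
      have h : Differentiable ℝ fun z : Fin (N + N) → ℝ =>
          ∑ j : Fin N, y j * z (Fin.natAdd N j) := by fun_prop
      exact Complex.ofRealCLM.differentiable.comp h
    have h3 := hG.comp h1
    exact (by fun_prop : Differentiable ℝ fun z : Fin (N + N) → ℝ =>
      Complex.exp (-(Complex.I * (dotR y (secondB z) : ℂ)))).mul h3
  have h := (hd z).hasFDerivAt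
  rw [fderiv_eq_sum_pD] at h
  refine h.congr_fderiv (Finset.sum_congr rfl fun j _ => ?_)
  refine congrArg _ (Eq.symm ?_)
  have hpd : ∀ f : (Fin (N + N) → ℝ) → ℂ, Differentiable ℝ f → ∀ z j,
      HasDerivAt (fun t : ℝ => f (z + t • (Pi.single j 1 : Fin (N + N) → ℝ))) (pD j f z) 0 := by
    intro f hf z j
    exact (hf z).hasFDerivAt.hasLineDerivAt _
  refine HasDerivAt.unique ?_ (hpd _ hd z j)
  refine Fin.addCases (fun k => ?_) (fun k => ?_) j
  · have h1 : ∀ t : ℝ, secondB (z + t • (Pi.single (Fin.castAdd N k) 1 : Fin (N + N) → ℝ)) =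
        secondB z := by
      intro t; ext i
      have : Fin.natAdd N i ≠ Fin.castAdd N k := by
        simp [Fin.ext_iff, -Fin.natAdd_eq_addNat]; omega
      simp [secondB, this, -Fin.natAdd_eq_addNat]
    have h2 : ∀ t : ℝ, Fin.append
        (firstB (z + t • (Pi.single (Fin.castAdd N k) 1 : Fin (N + N) → ℝ))) y =
        Fin.append (firstB z) y + t • (Pi.single (Fin.castAdd N k) 1 : Fin (N + N) → ℝ) := by
      intro t; ext i
      refine Fin.addCases (fun l => ?_) (fun l => ?_) i
      · simp [firstB, Pi.single_apply, -Fin.natAdd_eq_addNat]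
      · have : Fin.natAdd N l ≠ Fin.castAdd N k := by
          simp [Fin.ext_iff, -Fin.natAdd_eq_addNat]; omega
        simp [this, -Fin.natAdd_eq_addNat]
    simp only [h1, h2, dualDeriv, Fin.addCases_left]
    exact (hpd G hG _ _).const_mul _
  · have h1 : ∀ t : ℝ, dotR y (secondB
        (z + t • (Pi.single (Fin.natAdd N k) 1 : Fin (N + N) → ℝ))) =
        dotR y (secondB z) + t * y k := by
      intro t
      simp [dotR, secondB, Pi.single_apply, mul_add, Finset.sum_add_distrib,
        -Fin.natAdd_eq_addNat, Fin.natAdd_inj]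
      ring
    have h2 : ∀ t : ℝ, firstB
        (z + t • (Pi.single (Fin.natAdd N k) 1 : Fin (N + N) → ℝ)) = firstB z := by
      intro t; ext i
      have : Fin.castAdd N i ≠ Fin.natAdd N k := by
        simp [Fin.ext_iff, -Fin.natAdd_eq_addNat]; omega
      simp [firstB, this, -Fin.natAdd_eq_addNat]
    simp only [h1, h2, dualDeriv, Fin.addCases_right, Fin.append_right]
    have h3 : HasDerivAt (fun t : ℝ => ((dotR y (secondB z) + t * y k : ℝ) : ℂ)) (y k : ℂ) 0 := by
      have := (((hasDerivAt_id (0 : ℝ)).mul_const (y k)).const_add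
        (dotR y (secondB z))).ofReal_comp
      simpa using this
    have h4 := (((h3.const_mul Complex.I).neg).cexp).mul_const (G (Fin.append (firstB z) y))
    exact h4.congr_deriv (by simp; ring)

lemma Dec.hasFDerivAt_FT2 (hG : Dec (wOm a b) G) (hW : LogLow (wOm a b))
    (ha : ∀ x, 0 ≤ wSum a x) (hb : ∀ y, 0 ≤ wSum b y) (hbl : LogLow (wSum b))
    (z : Fin (N + N) → ℝ) :
    HasFDerivAt (FT2 G)
      (∑ j, (ContinuousLinearMap.proj (R := ℝ) (φ := fun _ : Fin (N + N) => ℝ) j).smulRight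
        (FT2 (_root_.dualDeriv G j) z)) z := by
  choose C hC using fun j => (hG.dualDeriv hW j).slice_bound_zero ha hb hbl
  exact hasFDerivAt_integral_sum_smulRight _
    (fun z => integrable_kernel_mul (hG.integrable_slice ha hb hbl _) _)
    (fun j z => integrable_kernel_mul ((hG.dualDeriv hW j).integrable_slice ha hb hbl _) _)
    (bound := fun j y => C j * (1 + ‖y‖) ^ (-((N : ℝ) + 1)))
    (fun j z y => by rw [norm_mul, norm_kernel, one_mul]; exact hC j _ y)
    (fun j => (integrable_rpow_neg N).const_mul _)
    (fun z y => hasFDerivAt_FT2_integrand hG.differentiable y z) z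

/-- The partial Fourier transform keeps the decay in the untouched variables. -/
lemma Dec.FT2_left (hG : Dec (wOm a b) G) (ha : ∀ j, IsWeightFun (a j))
    (hb : ∀ j, IsWeightFun (b j)) : Dec (fun z => wSum a (firstB z)) (FT2 G) := by
  have hW := logLow_wOm ha hb
  have ha0 := wSum_nonneg ha
  have hb0 := wSum_nonneg hb
  have hbl := logLow_wSum hb
  refine ⟨fun g => ∃ G, Dec (wOm a b) G ∧ g = FT2 G, ⟨G, hG, rfl⟩, ?_⟩
  rintro _ ⟨G, hG, rfl⟩
  have hd := hG.hasFDerivAt_FT2 hW ha0 hb0 hbl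
  refine ⟨fun z => (hd z).differentiableAt, fun lam hl => ?_, fun j =>
    ⟨_, hG.dualDeriv hW j, ?_⟩⟩
  · obtain ⟨C, hC⟩ := hG.slice_bound ha0 hb0 hbl hl
    refine ⟨∫ y : Fin N → ℝ, C * (1 + ‖y‖) ^ (-((N : ℝ) + 1)), fun z => ?_⟩
    calc _ ≤ Real.exp (lam * wSum a (firstB z)) * ∫ y, ‖G (Fin.append (firstB z) y)‖ := by
          gcongr
          refine (norm_integral_le_integral_norm _).trans_eq ?_
          simp only [norm_mul, norm_kernel, one_mul]
      _ = ∫ y, Real.exp (lam * wSum a (firstB z)) * ‖G (Fin.append (firstB z) y)‖ :=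
          (integral_const_mul _ _).symm
      _ ≤ _ := integral_mono ((hG.integrable_slice ha0 hb0 hbl _).norm.const_mul _)
          ((integrable_rpow_neg N).const_mul _) fun y => hC _ y
  · ext z
    rw [_root_.pD, (hd z).fderiv]
    simp [Pi.single_apply]

/-- The partial Fourier transform exchanges the decay of a function in the transformed
variables with that of its Fourier transform. -/
lemma Dec.FT2 {c d : Fin N → ℝ → ℝ} (hG : Dec (wOm a b) G) (hFG : Dec (wOm c d) (FT G))
    (ha : ∀ j, IsWeightFun (a j)) (hb : ∀ j, IsWeightFun (b j))
    (hc : ∀ j, IsWeightFun (c j)) (hd : ∀ j, IsWeightFun (d j)) (hi : Integrable G) :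
    Dec (wOm a d) (FT2 G) := by
  have h1 := hG.FT2_left ha hb
  have hslice : ∀ η, Integrable fun x => _root_.FT2 G (Fin.append x η) := fun η =>
    integrable_of_decay (logLow_wSum ha) (wSum_nonneg ha)
      (h1.differentiable.continuous.comp (continuous_append_left η)) fun lam hl => by
        obtain ⟨C, hC⟩ := h1.bound hl
        exact ⟨C, fun x => by simpa using hC (Fin.append x η)⟩
  have hFs := hFG.comp_swapB
  have hinv : ∀ x η, _root_.FT2 (fun w => FT G (swapB w)) (Fin.append η x) =
      (2 * Real.pi) ^ N * _root_.FT2 G (Fin.append (-x) η) := by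
    intro x η
    have e : (fun ξ => FT G (Fin.append ξ η)) =
        FT (fun x => _root_.FT2 G (Fin.append x η)) := by
      ext ξ
      rw [FT_eq_FT1_FT2 hi]
      simp [FT1, FT]
    have hFi : Integrable (FT fun x => _root_.FT2 G (Fin.append x η)) := by
      rw [← e]
      simpa using hFs.integrable_slice (wSum_nonneg hd) (wSum_nonneg hc) (logLow_wSum hc) η
    have hF := FT_FT (h1.differentiable.continuous.comp (continuous_append_left η)) (hslice η)
      hFi x
    simp only [Function.comp_apply] at hF
    rw [← hF]
    simp only [_root_.FT2, firstB_append, secondB_append, swapB_append]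
    rw [FT]
    exact integral_congr_ae (Eventually.of_forall fun ξ => congrArg _ (congrFun e ξ))
  have h2 := (hFs.FT2_left hd hc).comp_permScale finAddFlip
    (Fin.append (fun _ => 1) fun _ => -1) (((2 * Real.pi) ^ N : ℂ)⁻¹)
  simp only [permScale_finAddFlip, firstB_append, one_smul, neg_smul, hinv, neg_neg,
    append_firstB_secondB] at h2
  have hπ : ((2 * Real.pi) ^ N : ℂ) ≠ 0 :=
    pow_ne_zero _ (mul_ne_zero two_ne_zero (Complex.ofReal_ne_zero.2 Real.pi_ne_zero))
  simp only [inv_mul_cancel_left₀ hπ] at h2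
  exact h1.add_weight h2

lemma Dec.integrable_wOm (hG : Dec (wOm a b) G) (ha : ∀ j, IsWeightFun (a j))
    (hb : ∀ j, IsWeightFun (b j)) : Integrable G := by
  rw [wOm_eq_wSum_append] at hG
  exact integrable_of_decay (logLow_wSum (isWeightFun_append ha hb))
    (wSum_nonneg (isWeightFun_append ha hb)) hG.differentiable.continuous fun lam hl => hG.bound hl

lemma FT_FT2 {d : Fin N → ℝ → ℝ} (hG : Dec (wOm a b) G) (hFT : Dec (wOm a d) (FT2 G))
    (ha : ∀ j, IsWeightFun (a j)) (hb : ∀ j, IsWeightFun (b j)) (hd : ∀ j, IsWeightFun (d j)) :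
    FT (FT2 G) = fun z => (2 * Real.pi) ^ N * FT1 G (Fin.append (firstB z) (-secondB z)) := by
  have hFT2 : FT2 (FT2 G) = fun z =>
      (2 * Real.pi) ^ N * G (Fin.append (firstB z) (-secondB z)) := by
    ext z
    have e : (fun η => FT2 G (Fin.append (firstB z) η)) =
        FT fun y => G (Fin.append (firstB z) y) := by
      ext η; simp [FT2, FT]
    rw [← FT_FT (hG.continuous_slice _)
      (hG.integrable_slice (wSum_nonneg ha) (wSum_nonneg hb) (logLow_wSum hb) _), ← e]
    · rfl
    · rw [← e]
      exact hFT.integrable_slice (wSum_nonneg ha) (wSum_nonneg hd) (logLow_wSum hd) _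
  rw [FT_eq_FT1_FT2 (hFT.integrable_wOm ha hd), hFT2]
  ext z
  simp only [FT1, firstB_append, secondB_append]
  rw [← integral_const_mul]
  refine integral_congr_ae (Eventually.of_forall fun x => ?_)
  simp only
  ring

lemma MemS.comp_swapB {c d : Fin N → ℝ → ℝ} (h : MemS (wOm a b) (wOm c d) G)
    (ha : ∀ j, IsWeightFun (a j)) (hb : ∀ j, IsWeightFun (b j)) :
    MemS (wOm b a) (wOm d c) fun z => G (swapB z) := by
  rw [memS_iff] at h ⊢
  rw [FT_comp_swapB]
  exact ⟨h.2.1.comp_swapB.integrable_wOm hb ha, h.2.1.comp_swapB, h.2.2.comp_swapB⟩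

lemma Dec.FT1 {c d : Fin N → ℝ → ℝ} (h : MemS (wOm a b) (wOm c d) G)
    (ha : ∀ j, IsWeightFun (a j)) (hb : ∀ j, IsWeightFun (b j))
    (hc : ∀ j, IsWeightFun (c j)) (hd : ∀ j, IsWeightFun (d j)) :
    Dec (wOm c b) (FT1 G) := by
  have hs := memS_iff.1 (h.comp_swapB ha hb)
  rw [FT1_eq_FT2_swapB]
  exact (hs.2.1.FT2 hs.2.2 hb ha hd hc hs.1).comp_swapB

lemma MemS.FT2 {c d : Fin N → ℝ → ℝ} (h : MemS (wOm a b) (wOm c d) G)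
    (ha : ∀ j, IsWeightFun (a j)) (hb : ∀ j, IsWeightFun (b j))
    (hc : ∀ j, IsWeightFun (c j)) (hd : ∀ j, IsWeightFun (d j)) :
    MemS (wOm a d) (wOm c b) (FT2 G) := by
  obtain ⟨hi, hG, hFG⟩ := memS_iff.1 h
  have h2 := hG.FT2 hFG ha hb hc hd hi
  refine memS_iff.2 ⟨h2.integrable_wOm ha hd, h2, ?_⟩
  rw [FT_FT2 hG h2 ha hb hd]
  have h1 := (Dec.FT1 h ha hb hc hd).comp_permScale (Equiv.refl _)
    (Fin.append (fun _ => 1) fun _ => -1) ((2 * Real.pi) ^ N)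
  simp only [permScale_refl, one_smul, neg_smul] at h1
  refine h1.mono fun z => le_of_eq ?_
  have hneg : ∀ y, wSum b (-y) = wSum b y := fun y => by
    refine Finset.sum_congr rfl fun j _ => ?_
    rw [(hb j).eq_abs, (hb j).eq_abs (y j), Pi.neg_apply, abs_neg]
  rw [wOm_append, hneg, ← wOm_append, append_firstB_secondB]

lemma MemS.FT1 {c d : Fin N → ℝ → ℝ} (h : MemS (wOm a b) (wOm c d) G)
    (ha : ∀ j, IsWeightFun (a j)) (hb : ∀ j, IsWeightFun (b j))
    (hc : ∀ j, IsWeightFun (c j)) (hd : ∀ j, IsWeightFun (d j)) :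
    MemS (wOm c b) (wOm a d) (FT1 G) := by
  rw [FT1_eq_FT2_swapB]
  exact ((h.comp_swapB ha hb).FT2 hb ha hd hc).comp_swapB hb hc

end PartialFourier

/-- Mapping properties of the partial Fourier transforms on the spaces
`S_Ω^Σ(ℝ^{2N})` (Theorem 3.3 of the paper). -/
theorem statement_11 (N : ℕ) (ω1 ω2 σ1 σ2 : Fin N → ℝ → ℝ)
    (hω1 : ∀ j, IsWeightFun (ω1 j)) (hω2 : ∀ j, IsWeightFun (ω2 j))
    (hσ1 : ∀ j, IsWeightFun (σ1 j)) (hσ2 : ∀ j, IsWeightFun (σ2 j))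
    (F : (Fin (N + N) → ℝ) → ℂ)
    (hF : MemS (wOm ω1 ω2) (wOm σ1 σ2) F) :
    MemS (wOm ω1 σ2) (wOm σ1 ω2) (FT2 F) ∧
    MemS (wOm σ1 ω2) (wOm ω1 σ2) (FT1 F) := by
  exact ⟨hF.FT2 hω1 hω2 hσ1 hσ2, hF.FT1 hω1 hω2 hσ1 hσ2⟩

end
end

section
/- Let P(x,y,D_x,D_y) = Σ_{|α+β+γ+μ|≤m} c_{αβγμ} x^α y^β D_x^γ D_y^μ be a linear partial differential operator with polynomial coefficients on ℝ^{2N}. Then for every Schwartz function u on ℝ^{2N}: Wig[ P u ] = P̃ Wig[u], where P̃ = Σ_{|α+β+γ+μ|≤m} c_{αβγμ} (M_f − D_s/2)^α (M_f + D_s/2)^β (M_s + D_f/2)^γ (D_f/2 − M_s)^μ, the composition being applied from right to left in the order written. -/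
open MeasureTheory Filter
open scoped ENNReal NNReal

noncomputable section

/-- the Wigner-type transform
`Wig[u](x,ξ) = ∫ e^{-i t·ξ} u(x + t/2, x - t/2) dt`. -/
def Wig {N : ℕ} (u : (Fin (N + N) → ℝ) → ℂ) (z : Fin (N + N) → ℝ) : ℂ :=
  ∫ t : Fin N → ℝ, Complex.exp (-(Complex.I * (dotR t (secondB z) : ℂ))) *
    u (Fin.append (fun j => firstB z j + t j / 2) (fun j => firstB z j - t j / 2))

/-- operators acting on functions on `ℝ^M`. -/
abbrev OpC (M : ℕ) := ((Fin M → ℝ) → ℂ) → ((Fin M → ℝ) → ℂ)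

/-- multiplication by the coordinate `x_j`. -/
def mulC {M : ℕ} (j : Fin M) : OpC M := fun f x => (x j : ℂ) * f x

/-- the operator `D_j = -i ∂_j`. -/
def Dc {M : ℕ} (j : Fin M) : OpC M := fun f x => -Complex.I * pD j f x

/-- power `R^α = R_1^{α_1} ∘ ⋯ ∘ R_N^{α_N}` of a vector of (pairwise commuting)
operators. -/
def vecPow {M N : ℕ} (R : Fin N → OpC M) (α : Fin N → ℕ) : OpC M :=
  fun f => ((List.ofFn fun j : Fin N => (R j)^[α j]).foldr (· ∘ ·) id) f

/-! ### Compositions of powers of operators -/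

section Operators

variable {ι X Y : Type*}

/-- The composition of the powers `R_j^{α_j}` along a list of indices. -/
def listPow (R : ι → X → X) (α : ι → ℕ) (l : List ι) : X → X :=
  (l.map fun j => (R j)^[α j]).foldr (· ∘ ·) id

@[simp]
theorem listPow_nil (R : ι → X → X) (α : ι → ℕ) : listPow R α [] = id := rfl

theorem listPow_cons (R : ι → X → X) (α : ι → ℕ) (j : ι) (l : List ι) (f : X) :
    listPow R α (j :: l) f = (R j)^[α j] (listPow R α l f) := rfl

theorem listPow_append (R : ι → X → X) (α : ι → ℕ) (l l' : List ι) (f : X) :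
    listPow R α (l ++ l') f = listPow R α l (listPow R α l' f) := by
  induction l with
  | nil => rfl
  | cons j l ih => rw [List.cons_append, listPow_cons, listPow_cons, ih]

theorem listPow_map {κ : Type*} (R : ι → X → X) (α : ι → ℕ) (e : κ → ι) (l : List κ) :
    listPow R α (l.map e) = listPow (fun j => R (e j)) (fun j => α (e j)) l := by
  simp [listPow, Function.comp_def]

theorem listPow_semiconj {Φ : X → Y} {S : ι → X → X} {R : ι → Y → Y}
    (h : ∀ j, Function.Semiconj Φ (S j) (R j)) (α : ι → ℕ) (l : List ι) :
    Function.Semiconj Φ (listPow S α l) (listPow R α l) := by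
  induction l with
  | nil => exact fun _ => rfl
  | cons j l ih =>
    intro f
    rw [listPow_cons, listPow_cons, ((h j).iterate_right (α j)).eq, ih.eq]

end Operators

theorem vecPow_eq_listPow {M N : ℕ} (R : Fin N → OpC M) (α : Fin N → ℕ) :
    vecPow R α = listPow R α (List.finRange N) := by
  funext f
  rw [vecPow, listPow, List.ofFn_eq_map]

theorem pDpow_eq_listPow {M : ℕ} (α : Fin M → ℕ) :
    pDpow α = listPow pD α (List.finRange M) := by
  funext f
  rw [pDpow, listPow, List.ofFn_eq_map]

theorem pD_const_smul {M : ℕ} (j : Fin M) (a : ℂ) (f : (Fin M → ℝ) → ℂ) :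
    pD j (a • f) = a • pD j f := by
  funext x
  simp [pD, fderiv_const_smul_field]

theorem Dc_iterate {M : ℕ} (j : Fin M) (n : ℕ) (a : ℂ) (f : (Fin M → ℝ) → ℂ) :
    (Dc j)^[n] (a • f) = ((-Complex.I) ^ n * a) • (pD j)^[n] f := by
  induction n generalizing a f with
  | zero => simp
  | succ n ih =>
    have : Dc j (a • f) = (-Complex.I * a) • pD j f := by
      funext x
      simp [Dc, pD_const_smul, mul_assoc]
    rw [Function.iterate_succ_apply, Function.iterate_succ_apply, this, ih]
    ring_nf

theorem listPow_Dc {M : ℕ} (α : Fin M → ℕ) (l : List (Fin M)) (f : (Fin M → ℝ) → ℂ) :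
    listPow Dc α l f = (-Complex.I) ^ (l.map α).sum • listPow pD α l f := by
  induction l with
  | nil => simp
  | cons j l ih =>
    rw [listPow_cons, listPow_cons, ih, Dc_iterate, List.map_cons, List.sum_cons, pow_add]

theorem Dpow_eq_listPow {M : ℕ} (α : Fin M → ℕ) :
    Dpow α = listPow Dc α (List.finRange M) := by
  funext f x
  rw [listPow_Dc, ← List.ofFn_eq_map, List.sum_ofFn, ← pDpow_eq_listPow]
  rfl

theorem finRange_add (m n : ℕ) :
    List.finRange (m + n) =
      (List.finRange m).map (Fin.castAdd n) ++ (List.finRange n).map (Fin.natAdd m) := by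
  rw [← List.ofFn_eq_map, ← List.ofFn_eq_map, ← List.ofFn_fin_append, ← List.ofFn_id]
  congr 1
  funext i
  induction i using Fin.addCases <;> simp

theorem Dpow_append {m n : ℕ} (α : Fin m → ℕ) (β : Fin n → ℕ)
    (f : (Fin (m + n) → ℝ) → ℂ) :
    Dpow (Fin.append α β) f =
      vecPow (fun j => Dc (Fin.castAdd n j)) α (vecPow (fun j => Dc (Fin.natAdd m j)) β f) := by
  rw [Dpow_eq_listPow, finRange_add, listPow_append, listPow_map, listPow_map,
    vecPow_eq_listPow, vecPow_eq_listPow]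
  simp

theorem mulC_iterate {M : ℕ} (k : Fin M) (n : ℕ) (f : (Fin M → ℝ) → ℂ) (x : Fin M → ℝ) :
    (mulC k)^[n] f x = (x k : ℂ) ^ n * f x := by
  induction n with
  | zero => simp
  | succ n ih => rw [Function.iterate_succ_apply', mulC, ih]; ring

theorem vecPow_mulC {M N : ℕ} (e : Fin N → Fin M) (α : Fin N → ℕ) (f : (Fin M → ℝ) → ℂ)
    (x : Fin M → ℝ) :
    vecPow (fun j => mulC (e j)) α f x = ((∏ j, x (e j) ^ α j : ℝ) : ℂ) * f x := by
  have key : ∀ l : List (Fin N), listPow (fun j => mulC (e j)) α l f x =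
      (l.map fun j => (x (e j) : ℂ) ^ α j).prod * f x := by
    intro l
    induction l with
    | nil => simp
    | cons j l ih =>
      rw [listPow_cons, mulC_iterate, ih, List.map_cons, List.prod_cons, mul_assoc]
  rw [vecPow_eq_listPow, key, ← List.ofFn_eq_map, List.prod_ofFn]
  push_cast
  rfl

/-! ### Coordinate operators on Schwartz functions -/

section Schwartz

open SchwartzMap LineDeriv

variable {M : ℕ}

/-- Multiplication by the coordinate `x_k` on Schwartz functions. -/
def schwartzMul (k : Fin M) (u : SchwartzMap (Fin M → ℝ) ℂ) : SchwartzMap (Fin M → ℝ) ℂ :=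
  smulLeftCLM ℂ (fun x : Fin M → ℝ => (x k : ℂ)) u

/-- The operator `D_k = -i ∂_k` on Schwartz functions. -/
def schwartzD (k : Fin M) (u : SchwartzMap (Fin M → ℝ) ℂ) : SchwartzMap (Fin M → ℝ) ℂ :=
  (-Complex.I) • lineDerivOp (Pi.single k (1 : ℝ) : Fin M → ℝ) u

theorem coe_schwartzMul (k : Fin M) (u : SchwartzMap (Fin M → ℝ) ℂ) :
    ⇑(schwartzMul k u) = mulC k u := by
  have h : Function.HasTemperateGrowth fun x : Fin M → ℝ => (x k : ℂ) :=
    (Complex.ofRealCLM.comp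
      (ContinuousLinearMap.proj (R := ℝ) (φ := fun _ : Fin M => ℝ) k)).hasTemperateGrowth
  funext x
  simp [schwartzMul, mulC, smulLeftCLM_apply_apply h]

theorem coe_schwartzD (k : Fin M) (u : SchwartzMap (Fin M → ℝ) ℂ) :
    ⇑(schwartzD k u) = Dc k u := by
  funext x
  simp [schwartzD, Dc, pD, lineDerivOp_apply_eq_fderiv]

end Schwartz

/-! ### The Wigner transform of Schwartz functions -/

section Wigner

open Complex

variable {N : ℕ}

/-- The linear map `(x, ξ) ↦ (x, x)`. -/
def wigDiag (N : ℕ) : (Fin (N + N) → ℝ) →L[ℝ] (Fin (N + N) → ℝ) :=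
  ContinuousLinearMap.pi (Fin.append
    (fun j => ContinuousLinearMap.proj (Fin.castAdd N j))
    (fun j => ContinuousLinearMap.proj (Fin.castAdd N j)))

/-- The linear map `t ↦ (t/2, -t/2)`. -/
def wigAnti (N : ℕ) : (Fin N → ℝ) →L[ℝ] (Fin (N + N) → ℝ) :=
  ContinuousLinearMap.pi (Fin.append
    (fun j => (1 / 2 : ℝ) • ContinuousLinearMap.proj j)
    (fun j => (-1 / 2 : ℝ) • ContinuousLinearMap.proj j))

/-- The bilinear pairing `(t, (x, ξ)) ↦ t·ξ`. -/
def wigPair (N : ℕ) : (Fin N → ℝ) →L[ℝ] (Fin (N + N) → ℝ) →L[ℝ] ℝ :=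
  ∑ j, (ContinuousLinearMap.proj (R := ℝ) (φ := fun _ : Fin N => ℝ) j).smulRight
    (ContinuousLinearMap.proj (R := ℝ) (φ := fun _ : Fin (N + N) => ℝ) (Fin.natAdd N j))

/-- The point `(x + t/2, x - t/2)`. -/
def wigPoint (z : Fin (N + N) → ℝ) (t : Fin N → ℝ) : Fin (N + N) → ℝ := wigDiag N z + wigAnti N t

/-- The phase `e^{-i t·ξ}`. -/
def wigPhase (z : Fin (N + N) → ℝ) (t : Fin N → ℝ) : ℂ := cexp (-(I * (wigPair N t z : ℂ)))

@[simp]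
theorem wigPoint_castAdd (z : Fin (N + N) → ℝ) (t : Fin N → ℝ) (j : Fin N) :
    wigPoint z t (Fin.castAdd N j) = z (Fin.castAdd N j) + t j / 2 := by
  simp [wigPoint, wigDiag, wigAnti]; ring

@[simp]
theorem wigPoint_natAdd (z : Fin (N + N) → ℝ) (t : Fin N → ℝ) (j : Fin N) :
    wigPoint z t (Fin.natAdd N j) = z (Fin.castAdd N j) - t j / 2 := by
  simp [-Fin.natAdd_eq_addNat, wigPoint, wigDiag, wigAnti]; ring

theorem wigPair_apply (t : Fin N → ℝ) (z : Fin (N + N) → ℝ) :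
    wigPair N t z = dotR t (secondB z) := by
  simp [wigPair, dotR, secondB]

theorem Wig_eq (u : (Fin (N + N) → ℝ) → ℂ) (z : Fin (N + N) → ℝ) :
    Wig u z = ∫ t, wigPhase z t * u (wigPoint z t) := by
  unfold Wig
  congr with t
  rw [wigPhase, wigPair_apply]
  congr 2
  funext i
  induction i using Fin.addCases <;> simp [-Fin.natAdd_eq_addNat, firstB]

theorem norm_wigPhase (z : Fin (N + N) → ℝ) (t : Fin N → ℝ) : ‖wigPhase z t‖ = 1 := by
  simp [wigPhase, Complex.norm_exp]

theorem continuous_wigPoint (z : Fin (N + N) → ℝ) : Continuous (wigPoint z) := by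
  unfold wigPoint; fun_prop

theorem continuous_wigPhase (z : Fin (N + N) → ℝ) : Continuous (wigPhase z) := by
  have : Continuous fun t => wigPair N t z := (wigPair N).continuous.clm_apply continuous_const
  unfold wigPhase
  fun_prop

theorem norm_le_two_mul_norm_wigPoint (z : Fin (N + N) → ℝ) (t : Fin N → ℝ) :
    ‖t‖ ≤ 2 * ‖wigPoint z t‖ := by
  refine (pi_norm_le_iff_of_nonneg (by positivity)).2 fun j => ?_
  have h1 := norm_le_pi_norm (wigPoint z t) (Fin.castAdd N j)
  have h2 := norm_le_pi_norm (wigPoint z t) (Fin.natAdd N j)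
  have h : t j = wigPoint z t (Fin.castAdd N j) - wigPoint z t (Fin.natAdd N j) := by
    rw [wigPoint_castAdd, wigPoint_natAdd]; ring
  calc ‖t j‖ ≤ ‖wigPoint z t (Fin.castAdd N j)‖ + ‖wigPoint z t (Fin.natAdd N j)‖ := by
        rw [h]; exact norm_sub_le _ _
    _ ≤ 2 * ‖wigPoint z t‖ := by linarith

variable {V : Type*} [NormedAddCommGroup V] [NormedSpace ℝ V]

theorem exists_wigPoint_decay (w : SchwartzMap (Fin (N + N) → ℝ) V) (k : ℕ) :
    ∃ C, 0 ≤ C ∧ ∀ z t, (1 + ‖t‖) ^ k * ‖w (wigPoint z t)‖ ≤ C := by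
  refine ⟨2 ^ k * (2 ^ k *
    (Finset.Iic (k, 0)).sup (fun m => SchwartzMap.seminorm ℝ m.1 m.2) w), by positivity,
    fun z t => ?_⟩
  have h := SchwartzMap.one_add_le_sup_seminorm_apply (𝕜 := ℝ) (m := (k, 0)) (k := k) (n := 0)
    le_rfl le_rfl w (wigPoint z t)
  rw [norm_iteratedFDeriv_zero] at h
  calc (1 + ‖t‖) ^ k * ‖w (wigPoint z t)‖
      ≤ (2 * (1 + ‖wigPoint z t‖)) ^ k * ‖w (wigPoint z t)‖ := by
        gcongr
        linarith [norm_le_two_mul_norm_wigPoint z t]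
    _ = 2 ^ k * ((1 + ‖wigPoint z t‖) ^ k * ‖w (wigPoint z t)‖) := by
        rw [mul_pow, mul_assoc]
    _ ≤ _ := by gcongr

/-- The integrable weight dominating the Wigner integrands. -/
def wigBound (N : ℕ) (t : Fin N → ℝ) : ℝ := ((1 + ‖t‖) ^ (N + 1))⁻¹

theorem integrable_wigBound : Integrable (wigBound N) := by
  have h := integrable_one_add_norm (E := Fin N → ℝ) (μ := volume) (r := (N + 1 : ℕ))
    (by simp)
  refine h.congr (Filter.Eventually.of_forall fun t => ?_)
  simp only [wigBound]
  rw [Real.rpow_neg (by positivity), Real.rpow_natCast]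

theorem exists_one_add_mul_norm_le (w : SchwartzMap (Fin (N + N) → ℝ) V) :
    ∃ C, 0 ≤ C ∧ ∀ z t, (1 + ‖t‖) * ‖w (wigPoint z t)‖ ≤ C * wigBound N t := by
  obtain ⟨C, hC, h⟩ := exists_wigPoint_decay w (N + 2)
  refine ⟨C, hC, fun z t => ?_⟩
  rw [wigBound, ← div_eq_mul_inv, le_div_iff₀ (by positivity)]
  calc _ = (1 + ‖t‖) ^ (N + 2) * ‖w (wigPoint z t)‖ := by ring
    _ ≤ C := h z t

theorem integrable_wig (u : SchwartzMap (Fin (N + N) → ℝ) ℂ) (z : Fin (N + N) → ℝ) :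
    Integrable fun t => wigPhase z t * u (wigPoint z t) := by
  obtain ⟨C, hC, h⟩ := exists_one_add_mul_norm_le u
  refine (integrable_wigBound.const_mul C).mono'
    ((continuous_wigPhase z).mul
      (u.continuous.comp (continuous_wigPoint z))).aestronglyMeasurable
    (Filter.Eventually.of_forall fun t => ?_)
  rw [norm_mul, norm_wigPhase, one_mul]
  exact (le_mul_of_one_le_left (norm_nonneg _) (by simp)).trans (h z t)

/-- The Wigner transform as a linear map on Schwartz functions. -/
def wigLinear (N : ℕ) :
    SchwartzMap (Fin (N + N) → ℝ) ℂ →ₗ[ℂ] ((Fin (N + N) → ℝ) → ℂ) where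
  toFun u := Wig u
  map_add' u v := by
    funext z
    simp only [Wig_eq, add_apply, Pi.add_apply, mul_add]
    exact integral_add (integrable_wig u z) (integrable_wig v z)
  map_smul' a u := by
    funext z
    simp only [Wig_eq, smul_apply, Pi.smul_apply, smul_eq_mul, RingHom.id_apply,
      mul_left_comm _ a]
    exact integral_const_mul a _

theorem wigLinear_apply (u : SchwartzMap (Fin (N + N) → ℝ) ℂ) : wigLinear N u = Wig u := rfl

theorem hasFDerivAt_wigPhase_left (z : Fin (N + N) → ℝ) (t : Fin N → ℝ) :
    HasFDerivAt (fun z => wigPhase z t)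
      (wigPhase z t • (-I) • ofRealCLM.comp (wigPair N t)) z := by
  have h := ((ofRealCLM.comp (wigPair N t)).hasFDerivAt (x := z)).const_mul (-I)
  simpa [wigPhase, Function.comp_def] using h.cexp

theorem hasFDerivAt_wigPhase_right (z : Fin (N + N) → ℝ) (t : Fin N → ℝ) :
    HasFDerivAt (fun t => wigPhase z t)
      (wigPhase z t • (-I) • ofRealCLM.comp ((wigPair N).flip z)) t := by
  have h := ((ofRealCLM.comp ((wigPair N).flip z)).hasFDerivAt (x := t)).const_mul (-I)
  simpa [wigPhase, Function.comp_def] using h.cexp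

theorem hasFDerivAt_wigPoint_left (u : SchwartzMap (Fin (N + N) → ℝ) ℂ) (z : Fin (N + N) → ℝ)
    (t : Fin N → ℝ) :
    HasFDerivAt (fun z => u (wigPoint z t))
      ((fderiv ℝ u (wigPoint z t)).comp (wigDiag N)) z :=
  (u.differentiableAt.hasFDerivAt (x := wigPoint z t)).comp z
    ((wigDiag N).hasFDerivAt.add_const _)

theorem hasFDerivAt_wigPoint_right (u : SchwartzMap (Fin (N + N) → ℝ) ℂ) (z : Fin (N + N) → ℝ)
    (t : Fin N → ℝ) :
    HasFDerivAt (fun t => u (wigPoint z t))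
      ((fderiv ℝ u (wigPoint z t)).comp (wigAnti N)) t :=
  (u.differentiableAt.hasFDerivAt (x := wigPoint z t)).comp t
    ((wigAnti N).hasFDerivAt.const_add _)

/-- The derivative in `z` of the integrand of the Wigner transform. -/
def wigDeriv (u : SchwartzMap (Fin (N + N) → ℝ) ℂ) (z : Fin (N + N) → ℝ) (t : Fin N → ℝ) :
    (Fin (N + N) → ℝ) →L[ℝ] ℂ :=
  wigPhase z t • (fderiv ℝ u (wigPoint z t)).comp (wigDiag N) +
    u (wigPoint z t) • wigPhase z t • (-I) • ofRealCLM.comp (wigPair N t)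

theorem continuous_wigDeriv (u : SchwartzMap (Fin (N + N) → ℝ) ℂ) (z : Fin (N + N) → ℝ) :
    Continuous (wigDeriv u z) := by
  have h1 := continuous_wigPhase z
  have h2 := u.continuous.comp (continuous_wigPoint z)
  have h3 : Continuous fun t => fderiv ℝ u (wigPoint z t) :=
    (SchwartzMap.fderivCLM ℝ _ _ u).continuous.comp (continuous_wigPoint z)
  have h4 : Continuous fun t => ofRealCLM.comp (wigPair N t) :=
    continuous_const.clm_comp (wigPair N).continuous
  exact (h1.smul (h3.clm_comp continuous_const)).add (h2.smul (h1.smul (h4.const_smul (-I))))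

theorem exists_norm_wigDeriv_le (u : SchwartzMap (Fin (N + N) → ℝ) ℂ) :
    ∃ C, ∀ z t, ‖wigDeriv u z t‖ ≤ C * wigBound N t := by
  obtain ⟨C, hC, h⟩ := exists_one_add_mul_norm_le u
  obtain ⟨C', hC', h'⟩ := exists_one_add_mul_norm_le (SchwartzMap.fderivCLM ℝ _ _ u)
  refine ⟨C' * ‖wigDiag N‖ + C * (‖ofRealCLM‖ * ‖wigPair N‖), fun z t => ?_⟩
  have hu : ‖fderiv ℝ u (wigPoint z t)‖ ≤ C' * wigBound N t :=
    (le_mul_of_one_le_left (norm_nonneg _) (by simp)).trans (h' z t)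
  have ht : ‖t‖ * ‖u (wigPoint z t)‖ ≤ C * wigBound N t :=
    (mul_le_mul_of_nonneg_right (by linarith) (norm_nonneg _)).trans (h z t)
  calc ‖wigDeriv u z t‖
      ≤ ‖(fderiv ℝ u (wigPoint z t)).comp (wigDiag N)‖ +
        ‖u (wigPoint z t)‖ * ‖ofRealCLM.comp (wigPair N t)‖ := by
        refine (norm_add_le _ _).trans_eq ?_
        simp only [norm_smul, norm_wigPhase, norm_neg, norm_I, one_mul]
    _ ≤ ‖fderiv ℝ u (wigPoint z t)‖ * ‖wigDiag N‖ +
        ‖u (wigPoint z t)‖ * (‖ofRealCLM‖ * (‖wigPair N‖ * ‖t‖)) := by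
        gcongr
        · exact ContinuousLinearMap.opNorm_comp_le _ _
        · exact (ContinuousLinearMap.opNorm_comp_le _ _).trans
            (by gcongr; exact (wigPair N).le_opNorm t)
    _ = ‖fderiv ℝ u (wigPoint z t)‖ * ‖wigDiag N‖ +
        ‖t‖ * ‖u (wigPoint z t)‖ * (‖ofRealCLM‖ * ‖wigPair N‖) := by ring
    _ ≤ C' * wigBound N t * ‖wigDiag N‖ +
        C * wigBound N t * (‖ofRealCLM‖ * ‖wigPair N‖) := by gcongr
    _ = _ := by ring

theorem integrable_wigDeriv (u : SchwartzMap (Fin (N + N) → ℝ) ℂ) (z : Fin (N + N) → ℝ) :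
    Integrable (wigDeriv u z) := by
  obtain ⟨C, hC⟩ := exists_norm_wigDeriv_le u
  exact (integrable_wigBound.const_mul C).mono' (continuous_wigDeriv u z).aestronglyMeasurable
    (Filter.Eventually.of_forall (hC z))

theorem hasFDerivAt_Wig (u : SchwartzMap (Fin (N + N) → ℝ) ℂ) (z : Fin (N + N) → ℝ) :
    HasFDerivAt (Wig u) (∫ t, wigDeriv u z t) z := by
  obtain ⟨C, hC⟩ := exists_norm_wigDeriv_le u
  have h := hasFDerivAt_integral_of_dominated_of_fderiv_le (μ := volume) (𝕜 := ℝ)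
    (F := fun z t => wigPhase z t * u (wigPoint z t)) (F' := wigDeriv u)
    (x₀ := z) (s := Set.univ) (bound := fun t => C * wigBound N t) Filter.univ_mem
    (Filter.Eventually.of_forall fun z => (integrable_wig u z).aestronglyMeasurable)
    (integrable_wig u z) (continuous_wigDeriv u z).aestronglyMeasurable
    (Filter.Eventually.of_forall fun t z _ => hC z t) (integrable_wigBound.const_mul C)
    (Filter.Eventually.of_forall fun t z _ =>
      (hasFDerivAt_wigPhase_left z t).mul (hasFDerivAt_wigPoint_left u z t))
  exact h.congr_of_eventuallyEq (Filter.Eventually.of_forall (Wig_eq u))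

theorem pD_Wig (u : SchwartzMap (Fin (N + N) → ℝ) ℂ) (k : Fin (N + N)) (z : Fin (N + N) → ℝ) :
    pD k (Wig u) z = ∫ t, wigDeriv u z t (Pi.single k 1) := by
  rw [pD, (hasFDerivAt_Wig u z).fderiv,
    ContinuousLinearMap.integral_apply (integrable_wigDeriv u z)]

theorem wigDiag_single_castAdd (j : Fin N) :
    wigDiag N (Pi.single (Fin.castAdd N j) 1) =
      Pi.single (Fin.castAdd N j) 1 + Pi.single (Fin.natAdd N j) 1 := by
  funext i
  induction i using Fin.addCases <;> simp [-Fin.natAdd_eq_addNat, wigDiag, Pi.single_apply, Fin.ext_iff] <;> omega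

theorem wigDiag_single_natAdd (j : Fin N) : wigDiag N (Pi.single (Fin.natAdd N j) 1) = 0 := by
  funext i
  induction i using Fin.addCases <;> simp [-Fin.natAdd_eq_addNat, wigDiag, Pi.single_apply, Fin.ext_iff] <;> omega

theorem wigAnti_single (j : Fin N) :
    wigAnti N (Pi.single j 1) =
      (1 / 2 : ℝ) • (Pi.single (Fin.castAdd N j) 1 - Pi.single (Fin.natAdd N j) 1) := by
  funext i
  induction i using Fin.addCases <;>
    simp [-Fin.natAdd_eq_addNat, wigAnti, Pi.single_apply, Fin.ext_iff] <;> grind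

theorem wigPair_single_castAdd (t : Fin N → ℝ) (j : Fin N) :
    wigPair N t (Pi.single (Fin.castAdd N j) 1) = 0 := by
  rw [wigPair_apply, dotR]
  refine Finset.sum_eq_zero fun i _ => ?_
  rw [secondB, Pi.single_eq_of_ne (by simp [Fin.ext_iff]; omega), mul_zero]

theorem wigPair_single_natAdd (t : Fin N → ℝ) (j : Fin N) :
    wigPair N t (Pi.single (Fin.natAdd N j) 1) = t j := by
  simp [wigPair_apply, dotR, secondB, Pi.single_apply]

theorem wigPair_single_left (j : Fin N) (z : Fin (N + N) → ℝ) :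
    wigPair N (Pi.single j 1) z = z (Fin.natAdd N j) := by
  simp [wigPair_apply, dotR, secondB, Pi.single_apply]

theorem Dc_castAdd_Wig (u : SchwartzMap (Fin (N + N) → ℝ) ℂ) (j : Fin N) :
    Dc (Fin.castAdd N j) (Wig u) =
      Wig ⇑(schwartzD (Fin.castAdd N j) u + schwartzD (Fin.natAdd N j) u) := by
  funext z
  rw [Dc, pD_Wig, Wig_eq, ← integral_const_mul]
  congr with t
  simp [-Fin.natAdd_eq_addNat, wigDeriv, wigDiag_single_castAdd, wigPair_single_castAdd, coe_schwartzD, Dc, pD]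
  ring

theorem Dc_natAdd_Wig (u : SchwartzMap (Fin (N + N) → ℝ) ℂ) (j : Fin N) :
    Dc (Fin.natAdd N j) (Wig u) =
      Wig ⇑(schwartzMul (Fin.natAdd N j) u - schwartzMul (Fin.castAdd N j) u) := by
  funext z
  rw [Dc, pD_Wig, Wig_eq, ← integral_const_mul]
  congr with t
  simp [-Fin.natAdd_eq_addNat, wigDeriv, wigDiag_single_natAdd, wigPair_single_natAdd, coe_schwartzMul, mulC]
  linear_combination (u (wigPoint z t) * wigPhase z t * t j) * I_mul_I

theorem mulC_castAdd_Wig (u : SchwartzMap (Fin (N + N) → ℝ) ℂ) (j : Fin N) :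
    mulC (Fin.castAdd N j) (Wig u) =
      Wig ⇑((1 / 2 : ℂ) • (schwartzMul (Fin.castAdd N j) u + schwartzMul (Fin.natAdd N j) u)) := by
  funext z
  rw [mulC, Wig_eq, Wig_eq, ← integral_const_mul]
  congr with t
  simp [-Fin.natAdd_eq_addNat, coe_schwartzMul, mulC]
  ring

theorem mulC_natAdd_Wig (u : SchwartzMap (Fin (N + N) → ℝ) ℂ) (j : Fin N) :
    mulC (Fin.natAdd N j) (Wig u) =
      Wig ⇑((1 / 2 : ℂ) • (schwartzD (Fin.castAdd N j) u - schwartzD (Fin.natAdd N j) u)) := by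
  funext z
  set v := (1 / 2 : ℂ) • (schwartzD (Fin.castAdd N j) u - schwartzD (Fin.natAdd N j) u) with hv
  have hphase (t : Fin N → ℝ) :
      fderiv ℝ (wigPhase z) t (Pi.single j 1) = -I * z (Fin.natAdd N j) * wigPhase z t := by
    rw [(hasFDerivAt_wigPhase_right z t).fderiv]
    simp [wigPair_single_left]
    ring
  have hpoint (t : Fin N → ℝ) :
      fderiv ℝ (fun t => u (wigPoint z t)) t (Pi.single j 1) = I * v (wigPoint z t) := by
    rw [(hasFDerivAt_wigPoint_right u z t).fderiv]
    simp [-Fin.natAdd_eq_addNat, hv, wigAnti_single, coe_schwartzD, Dc, pD]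
    linear_combination (-(1 / 2 : ℂ) * (fderiv ℝ u (wigPoint z t) (Pi.single (Fin.natAdd N j) 1) -
      fderiv ℝ u (wigPoint z t) (Pi.single (Fin.castAdd N j) 1))) * I_mul_I
  have h := integral_mul_fderiv_eq_neg_fderiv_mul_of_integrable (μ := volume)
    (f := wigPhase z) (g := fun t => u (wigPoint z t)) (v := Pi.single j 1)
    (by
      simp only [hphase, mul_assoc]
      exact ((integrable_wig u z).const_mul _).const_mul _)
    (by
      simp only [hpoint, mul_left_comm _ I]
      exact (integrable_wig v z).const_mul _)
    (integrable_wig u z)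
    (fun t _ => (hasFDerivAt_wigPhase_right z t).differentiableAt)
    (fun t _ => (hasFDerivAt_wigPoint_right u z t).differentiableAt)
  simp only [hphase, hpoint, mul_left_comm _ I, mul_assoc, integral_const_mul, ← Wig_eq] at h
  rw [mulC]
  linear_combination (I) * h + (z (Fin.natAdd N j) * Wig u z - Wig v z) * I_mul_I

end Wigner

theorem semiconj_Wig_x {N : ℕ} (j : Fin N) :
    Function.Semiconj (fun u : SchwartzMap (Fin (N + N) → ℝ) ℂ => Wig ⇑u)
      (schwartzMul (Fin.castAdd N j))
      (mulC (Fin.castAdd N j) - ((1 : ℂ) / 2) • Dc (Fin.natAdd N j)) := fun u => by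
  simp only [Pi.sub_apply, Pi.smul_apply, mulC_castAdd_Wig, Dc_natAdd_Wig]
  simp only [← wigLinear_apply, map_smul, map_add, map_sub]
  module

theorem semiconj_Wig_y {N : ℕ} (j : Fin N) :
    Function.Semiconj (fun u : SchwartzMap (Fin (N + N) → ℝ) ℂ => Wig ⇑u)
      (schwartzMul (Fin.natAdd N j))
      (mulC (Fin.castAdd N j) + ((1 : ℂ) / 2) • Dc (Fin.natAdd N j)) := fun u => by
  simp only [Pi.add_apply, Pi.smul_apply, mulC_castAdd_Wig, Dc_natAdd_Wig]
  simp only [← wigLinear_apply, map_smul, map_add, map_sub]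
  module

theorem semiconj_Wig_Dx {N : ℕ} (j : Fin N) :
    Function.Semiconj (fun u : SchwartzMap (Fin (N + N) → ℝ) ℂ => Wig ⇑u)
      (schwartzD (Fin.castAdd N j))
      (mulC (Fin.natAdd N j) + ((1 : ℂ) / 2) • Dc (Fin.castAdd N j)) := fun u => by
  simp only [Pi.add_apply, Pi.smul_apply, mulC_natAdd_Wig, Dc_castAdd_Wig]
  simp only [← wigLinear_apply, map_smul, map_add, map_sub]
  module

theorem semiconj_Wig_Dy {N : ℕ} (j : Fin N) :
    Function.Semiconj (fun u : SchwartzMap (Fin (N + N) → ℝ) ℂ => Wig ⇑u)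
      (schwartzD (Fin.natAdd N j))
      (((1 : ℂ) / 2) • Dc (Fin.castAdd N j) - mulC (Fin.natAdd N j)) := fun u => by
  simp only [Pi.sub_apply, Pi.smul_apply, mulC_natAdd_Wig, Dc_castAdd_Wig]
  simp only [← wigLinear_apply, map_smul, map_add, map_sub]
  module

/-- The operator `x^α y^β D_x^γ D_y^μ` on Schwartz functions. -/
def schwartzMonomial {N : ℕ} (q : (Fin N → ℕ) × (Fin N → ℕ) × (Fin N → ℕ) × (Fin N → ℕ))
    (u : SchwartzMap (Fin (N + N) → ℝ) ℂ) : SchwartzMap (Fin (N + N) → ℝ) ℂ :=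
  listPow (fun j => schwartzMul (Fin.castAdd N j)) q.1 (List.finRange N)
    (listPow (fun j => schwartzMul (Fin.natAdd N j)) q.2.1 (List.finRange N)
      (listPow (fun j => schwartzD (Fin.castAdd N j)) q.2.2.1 (List.finRange N)
        (listPow (fun j => schwartzD (Fin.natAdd N j)) q.2.2.2 (List.finRange N) u)))

theorem coe_schwartzMonomial {N : ℕ}
    (q : (Fin N → ℕ) × (Fin N → ℕ) × (Fin N → ℕ) × (Fin N → ℕ))
    (u : SchwartzMap (Fin (N + N) → ℝ) ℂ) :
    ⇑(schwartzMonomial q u) = fun z : Fin (N + N) → ℝ =>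
      ((∏ j, (firstB z j) ^ (q.1 j) : ℝ) : ℂ) *
        (((∏ j, (secondB z j) ^ (q.2.1 j) : ℝ) : ℂ) *
          Dpow (Fin.append q.2.2.1 q.2.2.2) (⇑u) z) := by
  have hM (e : Fin N → Fin (N + N)) (α : Fin N → ℕ) (v : SchwartzMap (Fin (N + N) → ℝ) ℂ) :
      ⇑(listPow (fun j => schwartzMul (e j)) α (List.finRange N) v) =
        vecPow (fun j => mulC (e j)) α v := by
    rw [vecPow_eq_listPow]
    exact listPow_semiconj (Φ := fun v : SchwartzMap (Fin (N + N) → ℝ) ℂ => ⇑v)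
      (fun j => coe_schwartzMul (e j)) α _ v
  have hD (e : Fin N → Fin (N + N)) (α : Fin N → ℕ) (v : SchwartzMap (Fin (N + N) → ℝ) ℂ) :
      ⇑(listPow (fun j => schwartzD (e j)) α (List.finRange N) v) =
        vecPow (fun j => Dc (e j)) α v := by
    rw [vecPow_eq_listPow]
    exact listPow_semiconj (Φ := fun v : SchwartzMap (Fin (N + N) → ℝ) ℂ => ⇑v)
      (fun j => coe_schwartzD (e j)) α _ v
  funext z
  rw [schwartzMonomial, hM, hM, hD, hD, vecPow_mulC, vecPow_mulC, Dpow_append]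
  rfl

theorem Wig_schwartzMonomial {N : ℕ}
    (q : (Fin N → ℕ) × (Fin N → ℕ) × (Fin N → ℕ) × (Fin N → ℕ))
    (u : SchwartzMap (Fin (N + N) → ℝ) ℂ) :
    Wig ⇑(schwartzMonomial q u) =
      vecPow (fun j => mulC (Fin.castAdd N j) - ((1 : ℂ) / 2) • Dc (Fin.natAdd N j)) q.1
        (vecPow (fun j => mulC (Fin.castAdd N j) + ((1 : ℂ) / 2) • Dc (Fin.natAdd N j)) q.2.1
          (vecPow (fun j => mulC (Fin.natAdd N j) + ((1 : ℂ) / 2) • Dc (Fin.castAdd N j)) q.2.2.1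
            (vecPow (fun j => ((1 : ℂ) / 2) • Dc (Fin.castAdd N j) - mulC (Fin.natAdd N j))
              q.2.2.2 (Wig (⇑u))))) := by
  simp only [vecPow_eq_listPow]
  rw [← (listPow_semiconj semiconj_Wig_Dy q.2.2.2 (List.finRange N)).eq,
    ← (listPow_semiconj semiconj_Wig_Dx q.2.2.1 (List.finRange N)).eq,
    ← (listPow_semiconj semiconj_Wig_y q.2.1 (List.finRange N)).eq,
    ← (listPow_semiconj semiconj_Wig_x q.1 (List.finRange N)).eq, schwartzMonomial]

/-- For a partial differential operator `P` with polynomial coefficients,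
`Wig[P u] = P̃ Wig[u]` with
`P̃ = Σ c (M_f - D_s/2)^α (M_f + D_s/2)^β (M_s + D_f/2)^γ (D_f/2 - M_s)^μ`
(Proposition 4.7 of the paper). -/
theorem statement_15 (N m : ℕ)
    (F : Finset ((Fin N → ℕ) × (Fin N → ℕ) × (Fin N → ℕ) × (Fin N → ℕ)))
    (c : ((Fin N → ℕ) × (Fin N → ℕ) × (Fin N → ℕ) × (Fin N → ℕ)) → ℂ)
    (hdeg : ∀ q ∈ F, (∑ j, (q.1 j + q.2.1 j + q.2.2.1 j + q.2.2.2 j)) ≤ m)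
    (u : SchwartzMap ((Fin (N + N) → ℝ)) ℂ) :
    Wig (∑ q ∈ F, c q • (fun z : Fin (N + N) → ℝ =>
        ((∏ j, (firstB z j) ^ (q.1 j) : ℝ) : ℂ) *
          (((∏ j, (secondB z j) ^ (q.2.1 j) : ℝ) : ℂ) *
            Dpow (Fin.append q.2.2.1 q.2.2.2) (⇑u) z))) =
      ∑ q ∈ F, c q •
        vecPow (fun j => mulC (Fin.castAdd N j) - ((1 : ℂ) / 2) • Dc (Fin.natAdd N j)) q.1
          (vecPow (fun j => mulC (Fin.castAdd N j) + ((1 : ℂ) / 2) • Dc (Fin.natAdd N j)) q.2.1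
            (vecPow (fun j => mulC (Fin.natAdd N j) + ((1 : ℂ) / 2) • Dc (Fin.castAdd N j)) q.2.2.1
              (vecPow (fun j => ((1 : ℂ) / 2) • Dc (Fin.castAdd N j) - mulC (Fin.natAdd N j))
                q.2.2.2 (Wig (⇑u))))) := by
  have h : (∑ q ∈ F, c q • ⇑(schwartzMonomial q u)) =
      ⇑(∑ q ∈ F, c q • schwartzMonomial q u) := by
    funext z
    simp
  simp only [← coe_schwartzMonomial, ← Wig_schwartzMonomial]
  rw [h]
  simp only [← wigLinear_apply, map_sum, map_smul]

end
end
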